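/- arXiv:1508.05423 — 7 statements merged into one kernel-verified Lean document; each statement's English description precedes it below -/
import Mathlib

section
/- Suppose the time-varying conductance walk is uniformly lazy with parameter γ ∈ (0,1/2] (i.e. π^{(t)}(x,x) ≥ γ·π^{(t)}(x) for all t and x) and that all the quantities β(u) are finite. Fix d > 1 and λ ∈ (0,1/2]. Then there exists a finite constant c₊ = c₊(d,γ,λ) such that for all integers 0 ≤ s < t, all x ∈ V_s and y ∈ V_t for which there exists r ∈ (s,t) with (ψ_{d,β}(r) − ψ_{d,β}(s))/(ψ_{d,β}(t) − ψ_{d,β}(s)) ∈ [λ, 1−λ], one has h(s,x;t,y) ≤ c₊ · β(t) · (ψ_{d,β}(t) − ψ_{d,β}(s))^{−d/2}. -/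
open MeasureTheory

noncomputable section

namespace TimeVaryingConductances

/-- Vertex conductance `π^{(t)}(x) = ∑_y π^{(t)}(x,y)`. -/
def vc {V : Type} (π : ℕ → V → V → ℝ) (t : ℕ) (x : V) : ℝ := ∑' y, π t x y

/-- `π^{(t)}(A) = ∑_{a ∈ A} π^{(t)}(a)` for a finite set `A`. -/
def fMass {V : Type} (π : ℕ → V → V → ℝ) (t : ℕ) (A : Finset V) : ℝ := ∑ a ∈ A, vc π t a

open Classical in
/-- `π^{(t)}(A, Aᶜ)` for a finite set `A`. -/
def fCut {V : Type} (π : ℕ → V → V → ℝ) (t : ℕ) (A : Finset V) : ℝ :=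
  ∑ a ∈ A, ∑' b, if b ∈ A then 0 else π t a b

/-- Isoperimetric constant `κ_u` of order `d`. -/
def kappa {V : Type} (π : ℕ → V → V → ℝ) (d : ℝ) (u : ℕ) : ℝ :=
  sInf {r : ℝ | ∃ A : Finset V, A.Nonempty ∧ (∀ a ∈ A, 0 < vc π u a) ∧
    r = fCut π u A / fMass π u A ^ ((d - 1) / d)}

/-- Isoperimetric growth function `ψ_{d,β}(t) = ∑_{u<t} (β(u)^{1/d} κ_u)²`. -/
def psiB {V : Type} (π : ℕ → V → V → ℝ) (β : ℕ → ℝ) (d : ℝ) (t : ℕ) : ℝ :=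
  ∑ u ∈ Finset.range t, (β u ^ (1 / d) * kappa π d u) ^ 2

/-- One-step transition probability `P(t,x;t+1,y) = π^{(t)}(x,y)/π^{(t)}(x)`. -/
def step {V : Type} (π : ℕ → V → V → ℝ) (t : ℕ) (x y : V) : ℝ := π t x y / vc π t x

open Classical in
/-- `n`-step transition probability starting at time `s` (Chapman–Kolmogorov). -/
def Pn {V : Type} (π : ℕ → V → V → ℝ) (s : ℕ) : ℕ → V → V → ℝ
  | 0 => fun x y => if x = y then 1 else 0
  | n + 1 => fun x y => ∑' z, Pn π s n x z * step π (s + n) z y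

/-- Heat kernel `h(s,x;t,y) = P(s,x;t,y)/π^{(t)}(y)`. -/
def hk {V : Type} (π : ℕ → V → V → ℝ) (s t : ℕ) (x y : V) : ℝ :=
  Pn π s (t - s) x y / vc π t y

/-- The set of ratios `π^{(u)}(x)/π^{(u+1)}(x)`, `x ∈ V_u`, whose supremum drives
the recursion `β(u+1) = β(u)·sup_{x∈V_u} π^{(u)}(x)/π^{(u+1)}(x)`. -/
def ratioSet {V : Type} (π : ℕ → V → V → ℝ) (u : ℕ) : Set ℝ :=
  {r : ℝ | ∃ x : V, 0 < vc π u x ∧ r = vc π u x / vc π (u + 1) x}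

/-- A discrete co-area inequality: if every subset `A` of `S` retains at most a fraction `w`
of its mass, then so does every nonnegative function on `S`. -/
lemma sum_mul_min_le {V : Type*} (p : V → V → ℝ) (m : V → ℝ) (w : ℝ) (S : Finset V) :
    ∀ F : V → ℝ, (∀ x ∈ S, 0 ≤ F x) →
      (∀ A ⊆ S, ∑ x ∈ A, ∑ y ∈ A, p x y ≤ w * ∑ x ∈ A, m x) →
      ∑ x ∈ S, ∑ y ∈ S, p x y * min (F x) (F y) ≤ w * ∑ x ∈ S, m x * F x := by
  classical
  induction S using Finset.strongInduction with
  | H S ih =>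
    intro F hF hA
    rcases S.eq_empty_or_nonempty with rfl | hS
    · simp
    obtain ⟨x₀, hx₀, hmin⟩ := S.exists_min_image F hS
    have key := ih (S.erase x₀) (Finset.erase_ssubset hx₀) (fun x => F x - F x₀)
      (fun x hx => sub_nonneg.2 (hmin x (Finset.mem_of_mem_erase hx)))
      (fun A hAS => hA A (hAS.trans (Finset.erase_subset _ _)))
    have hzero : ∀ x ∈ S, 0 ≤ F x - F x₀ := fun x hx => sub_nonneg.2 (hmin x hx)
    have h1 : ∑ x ∈ S.erase x₀, ∑ y ∈ S.erase x₀, p x y * min (F x - F x₀) (F y - F x₀)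
        = ∑ x ∈ S, ∑ y ∈ S, p x y * min (F x - F x₀) (F y - F x₀) := by
      rw [← Finset.sum_erase S (a := x₀)]
      · refine Finset.sum_congr rfl fun x hx => Finset.sum_erase S ?_
        rw [sub_self, min_eq_right (hzero x (Finset.mem_of_mem_erase hx)), mul_zero]
      · refine Finset.sum_eq_zero fun y hy => ?_
        rw [sub_self, min_eq_left (hzero y hy), mul_zero]
    have h2 : ∑ x ∈ S.erase x₀, m x * (F x - F x₀) = ∑ x ∈ S, m x * (F x - F x₀) :=
      Finset.sum_erase S (by simp)
    have h3 : ∑ x ∈ S, ∑ y ∈ S, p x y * min (F x) (F y)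
        = F x₀ * ∑ x ∈ S, ∑ y ∈ S, p x y
          + ∑ x ∈ S, ∑ y ∈ S, p x y * min (F x - F x₀) (F y - F x₀) := by
      simp only [Finset.mul_sum, ← Finset.sum_add_distrib]
      refine Finset.sum_congr rfl fun x _ => Finset.sum_congr rfl fun y _ => ?_
      rw [min_sub_sub_right]
      ring
    have h4 : ∑ x ∈ S, m x * F x = F x₀ * ∑ x ∈ S, m x + ∑ x ∈ S, m x * (F x - F x₀) := by
      simp only [Finset.mul_sum, ← Finset.sum_add_distrib]
      exact Finset.sum_congr rfl fun x _ => by ring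
    have h5 := mul_le_mul_of_nonneg_left (hA S subset_rfl) (hF x₀ hx₀)
    rw [h3, h4, ← h1, ← h2]
    linarith

/-- For a symmetric kernel of row sums at most `m`, half the sum of `v x + v y` against the kernel
is at most the `m`-integral of `v`. -/
lemma sum_mul_half_add_le {V : Type*} {p : V → V → ℝ} {m : V → ℝ} {S : Finset V}
    (hsym : ∀ x y, p x y = p y x) (hm : ∀ x ∈ S, ∑ y ∈ S, p x y ≤ m x)
    {v : V → ℝ} (hv : ∀ x ∈ S, 0 ≤ v x) :
    ∑ x ∈ S, ∑ y ∈ S, p x y * ((v x + v y) / 2) ≤ ∑ x ∈ S, m x * v x := by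
  have h1 : ∑ x ∈ S, ∑ y ∈ S, p x y * v y = ∑ x ∈ S, ∑ y ∈ S, p x y * v x := by
    rw [Finset.sum_comm]
    exact Finset.sum_congr rfl fun x _ => Finset.sum_congr rfl fun y _ => by rw [hsym]
  have h2 : ∑ x ∈ S, ∑ y ∈ S, p x y * v x ≤ ∑ x ∈ S, m x * v x := by
    refine Finset.sum_le_sum fun x hx => ?_
    rw [← Finset.sum_mul]
    exact mul_le_mul_of_nonneg_right (hm x hx) (hv x hx)
  have h3 : ∑ x ∈ S, ∑ y ∈ S, p x y * ((v x + v y) / 2)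
      = (∑ x ∈ S, ∑ y ∈ S, p x y * v x + ∑ x ∈ S, ∑ y ∈ S, p x y * v y) / 2 := by
    simp only [← Finset.sum_add_distrib, Finset.sum_div]
    exact Finset.sum_congr rfl fun x _ => Finset.sum_congr rfl fun y _ => by ring
  linarith

/-- Cheeger's inequality for a (possibly substochastic) symmetric kernel on a finite set. -/
lemma cheeger {V : Type*} {p : V → V → ℝ} {m : V → ℝ} {S : Finset V} {φ : ℝ}
    (hp : ∀ x y, 0 ≤ p x y) (hsym : ∀ x y, p x y = p y x)
    (hm : ∀ x ∈ S, ∑ y ∈ S, p x y ≤ m x) (h0 : 0 ≤ φ) (h1 : φ < 1)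
    (hA : ∀ A ⊆ S, ∑ x ∈ A, ∑ y ∈ A, p x y ≤ (1 - φ) * ∑ x ∈ A, m x)
    (g : V → ℝ) :
    ∑ x ∈ S, ∑ y ∈ S, p x y * (g x * g y) ≤ (1 - φ ^ 2 / 2) * ∑ x ∈ S, m x * g x ^ 2 := by
  have hτ : 0 < 1 - φ := by linarith
  set Q := ((1 - φ)⁻¹ - (1 - φ)) / 2 with hQ
  have hQ0 : 0 ≤ Q := by
    have : 1 ≤ (1 - φ)⁻¹ := (one_le_inv₀ hτ).2 (by linarith)
    rw [hQ]; linarith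
  have hpt : ∀ a b : ℝ, a ^ 2 ≤ b ^ 2 →
      a * b ≤ Q * min (a ^ 2) (b ^ 2) + (1 - φ) * ((a ^ 2 + b ^ 2) / 2) := by
    intro a b hab
    rw [min_eq_left hab, hQ]
    have : 0 ≤ (1 - φ)⁻¹ * (a - (1 - φ) * b) ^ 2 := by positivity
    have e : (1 - φ)⁻¹ * (a - (1 - φ) * b) ^ 2
        = (1 - φ)⁻¹ * a ^ 2 - 2 * (a * b) + (1 - φ) * b ^ 2 := by
      field_simp; ring
    nlinarith
  have hpt' : ∀ a b : ℝ, a * b ≤ Q * min (a ^ 2) (b ^ 2) + (1 - φ) * ((a ^ 2 + b ^ 2) / 2) := by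
    intro a b
    rcases le_total (a ^ 2) (b ^ 2) with h | h
    · exact hpt a b h
    · have := hpt b a h
      rw [min_comm, add_comm (a ^ 2)]
      linarith [mul_comm a b]
  have e1 := sum_mul_min_le p m (1 - φ) S (fun x => g x ^ 2) (fun x _ => sq_nonneg _) hA
  have e2 := sum_mul_half_add_le hsym hm (v := fun x => g x ^ 2) (fun x _ => sq_nonneg _)
  have e3 : ∑ x ∈ S, ∑ y ∈ S, p x y * (g x * g y)
      ≤ Q * ∑ x ∈ S, ∑ y ∈ S, p x y * min (g x ^ 2) (g y ^ 2)
        + (1 - φ) * ∑ x ∈ S, ∑ y ∈ S, p x y * ((g x ^ 2 + g y ^ 2) / 2) := by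
    simp only [Finset.mul_sum, ← Finset.sum_add_distrib]
    refine Finset.sum_le_sum fun x _ => Finset.sum_le_sum fun y _ => ?_
    have := mul_le_mul_of_nonneg_left (hpt' (g x) (g y)) (hp x y)
    linarith
  have e4 := mul_le_mul_of_nonneg_left e1 hQ0
  have e5 := mul_le_mul_of_nonneg_left e2 hτ.le
  have e6 : Q * ((1 - φ) * ∑ x ∈ S, m x * g x ^ 2) + (1 - φ) * ∑ x ∈ S, m x * g x ^ 2
      = (1 - φ ^ 2 / 2) * ∑ x ∈ S, m x * g x ^ 2 := by
    rw [hQ]; field_simp; ring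
  linarith

/-- Truncation decreases the Dirichlet form. -/
lemma sum_mul_truncation_le {V : Type*} {p : V → V → ℝ} {m : V → ℝ} {W : Finset V}
    (hp : ∀ x y, 0 ≤ p x y) (hsym : ∀ x y, p x y = p y x)
    (hm : ∀ x ∈ W, ∑ y ∈ W, p x y ≤ m x)
    {f : V → ℝ} (hf : ∀ x ∈ W, 0 ≤ f x) {b : ℝ} (hb : 0 ≤ b) :
    ∑ x ∈ W, ∑ y ∈ W, p x y * (f x * f y)
      ≤ ∑ x ∈ W, ∑ y ∈ W, p x y * (max (f x - b) 0 * max (f y - b) 0)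
        + ∑ x ∈ W, m x * (f x ^ 2 - max (f x - b) 0 ^ 2) := by
  have h1 := sum_mul_half_add_le hsym hm (v := fun x => f x ^ 2 - max (f x - b) 0 ^ 2) (by
    intro x hx
    have h := hf x hx
    have h2 : max (f x - b) 0 ≤ f x := max_le (by linarith) h
    have h3 : 0 ≤ max (f x - b) 0 := le_max_right _ _
    nlinarith)
  refine le_trans ?_ (add_le_add_right h1 _)
  simp only [← Finset.sum_add_distrib]
  refine Finset.sum_le_sum fun x hx => Finset.sum_le_sum fun y hy => ?_
  rw [← mul_add]
  refine mul_le_mul_of_nonneg_left ?_ (hp x y)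
  have h4 : (max (f x - b) 0 - max (f y - b) 0) ^ 2 ≤ (f x - f y) ^ 2 := by
    rw [sq_le_sq]
    have := abs_max_sub_max_le_abs (f x - b) (f y - b) 0
    rwa [sub_sub_sub_cancel_right] at this
  nlinarith

/-- A variance bound for a weight with an atom at `x`. -/
lemma sq_sum_mul_le {V : Type*} {q : V → ℝ} {M γ : ℝ} {W : Finset V} {x : V} (hx : x ∈ W)
    (hq : ∀ y, 0 ≤ q y) (hM : ∑ y ∈ W, q y ≤ M) (hγ : 0 ≤ γ)
    (hlazy : γ * M ≤ q x) (f : V → ℝ) :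
    (∑ y ∈ W, q y * f y) ^ 2
      ≤ M * (∑ y ∈ W, q y * f y ^ 2 - γ * ∑ y ∈ W, q y * (f y - f x) ^ 2) := by
  classical
  set s := ∑ y ∈ W, q y with hs
  set D := ∑ y ∈ W, q y * (f y - f x) with hD
  set Q := ∑ y ∈ W, q y * (f y - f x) ^ 2 with hQ
  have hQ0 : 0 ≤ Q := Finset.sum_nonneg fun y _ => mul_nonneg (hq y) (sq_nonneg _)
  have e1 : ∑ y ∈ W, q y * f y = s * f x + D := by
    rw [hs, hD, Finset.sum_mul, ← Finset.sum_add_distrib]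
    exact Finset.sum_congr rfl fun y _ => by ring
  have e2 : ∑ y ∈ W, q y * f y ^ 2 = s * f x ^ 2 + 2 * f x * D + Q := by
    rw [hs, hD, hQ, Finset.sum_mul, Finset.mul_sum, ← Finset.sum_add_distrib,
      ← Finset.sum_add_distrib]
    exact Finset.sum_congr rfl fun y _ => by ring
  have e3 : D ^ 2 ≤ (s - q x) * Q := by
    have hDe : D = ∑ y ∈ W.erase x, q y * (f y - f x) :=
      (Finset.sum_erase W (by simp)).symm
    have hQe : Q = ∑ y ∈ W.erase x, q y * (f y - f x) ^ 2 :=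
      (Finset.sum_erase W (by simp)).symm
    have hse : s - q x = ∑ y ∈ W.erase x, q y := by
      rw [Finset.sum_erase_eq_sub hx]
    rw [hDe, hQe, hse]
    refine Finset.sum_sq_le_sum_mul_sum_of_sq_le_mul _ (fun y _ => hq y)
      (fun y _ => mul_nonneg (hq y) (sq_nonneg _)) fun y _ => le_of_eq (by ring)
  have hs0 : 0 ≤ s := Finset.sum_nonneg fun y _ => hq y
  have hbr : 0 ≤ ∑ y ∈ W, q y * f y ^ 2 - γ * Q := by
    rcases hs0.eq_or_lt with h | h
    · have hz : ∀ y ∈ W, q y = 0 := (Finset.sum_eq_zero_iff_of_nonneg fun y _ => hq y).1 h.symm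
      have h1 : ∑ y ∈ W, q y * f y ^ 2 = 0 :=
        Finset.sum_eq_zero fun y hy => by rw [hz y hy, zero_mul]
      have h2 : Q = 0 := Finset.sum_eq_zero fun y hy => by rw [hz y hy, zero_mul]
      rw [h1, h2]; simp
    · rw [e2]
      have h3 : 0 ≤ s * (s * f x ^ 2 + 2 * f x * D + Q - γ * Q) := by
        have h4 : γ * s ≤ q x := (mul_le_mul_of_nonneg_left hM hγ).trans hlazy
        nlinarith [sq_nonneg (s * f x + D), mul_le_mul_of_nonneg_right h4 hQ0]
      exact nonneg_of_mul_nonneg_right h3 h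
  refine le_trans ?_ (mul_le_mul_of_nonneg_right hM hbr)
  rw [e1, e2]
  have h4 : γ * s ≤ q x := (mul_le_mul_of_nonneg_left hM hγ).trans hlazy
  nlinarith [mul_le_mul_of_nonneg_right h4 hQ0]

/-- One step of a lazy reversible kernel contracts the squared `L²` norm by at least a multiple of
the Dirichlet form. -/
lemma sum_sq_div_le {V : Type*} {p : V → V → ℝ} {m : V → ℝ} {W : Finset V} {γ : ℝ}
    (hp : ∀ x y, 0 ≤ p x y) (hsym : ∀ x y, p x y = p y x)
    (hm : ∀ x ∈ W, ∑ y ∈ W, p x y ≤ m x) (hγ : 0 ≤ γ) (hγ2 : γ ≤ 1 / 2)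
    (hlazy : ∀ x, γ * m x ≤ p x x) (f : V → ℝ) :
    ∑ x ∈ W, (∑ y ∈ W, p x y * f y) ^ 2 / m x
      ≤ (1 - 2 * γ) * ∑ x ∈ W, m x * f x ^ 2
        + 2 * γ * ∑ x ∈ W, ∑ y ∈ W, p x y * (f x * f y) := by
  have h1 : ∀ x ∈ W, (∑ y ∈ W, p x y * f y) ^ 2 / m x
      ≤ ∑ y ∈ W, p x y * f y ^ 2 - γ * ∑ y ∈ W, p x y * (f y - f x) ^ 2 := by
    intro x hx
    have hm0 : 0 ≤ m x := (Finset.sum_nonneg fun y _ => hp x y).trans (hm x hx)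
    rcases hm0.eq_or_lt with h | h
    · have hz : ∀ y ∈ W, p x y = 0 := (Finset.sum_eq_zero_iff_of_nonneg fun y _ => hp x y).1
        (le_antisymm (h ▸ hm x hx) (Finset.sum_nonneg fun y _ => hp x y))
      rw [← h, div_zero, Finset.sum_eq_zero fun y hy => by rw [hz y hy, zero_mul],
        Finset.sum_eq_zero fun y hy => by rw [hz y hy, zero_mul]]
      simp
    · rw [div_le_iff₀' h]
      exact sq_sum_mul_le hx (hp x) (hm x hx) hγ (hlazy x) f
  have h2 := sum_mul_half_add_le hsym hm (v := fun x => f x ^ 2) (fun x _ => sq_nonneg _)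
  have hc : ∑ x ∈ W, ∑ y ∈ W, p x y * f y ^ 2
      = ∑ x ∈ W, ∑ y ∈ W, p x y * ((f x ^ 2 + f y ^ 2) / 2) := by
    have : ∑ x ∈ W, ∑ y ∈ W, p x y * f y ^ 2 = ∑ x ∈ W, ∑ y ∈ W, p x y * f x ^ 2 := by
      rw [Finset.sum_comm]
      exact Finset.sum_congr rfl fun x _ => Finset.sum_congr rfl fun y _ => by rw [hsym]
    have h3 : ∑ x ∈ W, ∑ y ∈ W, p x y * ((f x ^ 2 + f y ^ 2) / 2)
        = (∑ x ∈ W, ∑ y ∈ W, p x y * f x ^ 2 + ∑ x ∈ W, ∑ y ∈ W, p x y * f y ^ 2) / 2 := by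
      simp only [← Finset.sum_add_distrib, Finset.sum_div]
      exact Finset.sum_congr rfl fun x _ => Finset.sum_congr rfl fun y _ => by ring
    linarith
  have h4 : ∑ x ∈ W, ∑ y ∈ W, p x y * (f y - f x) ^ 2
      = 2 * ∑ x ∈ W, ∑ y ∈ W, p x y * ((f x ^ 2 + f y ^ 2) / 2)
        - 2 * ∑ x ∈ W, ∑ y ∈ W, p x y * (f x * f y) := by
    simp only [Finset.mul_sum, ← Finset.sum_sub_distrib]
    exact Finset.sum_congr rfl fun x _ => Finset.sum_congr rfl fun y _ => by ring
  have h5 := Finset.sum_le_sum h1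
  rw [Finset.sum_sub_distrib, ← Finset.mul_sum, hc, h4] at h5
  have h6 := mul_le_mul_of_nonneg_left h2 (by linarith : (0 : ℝ) ≤ 1 - 2 * γ)
  nlinarith

/-- Nash-type decay of the squared `L²` norm in one step of a lazy reversible kernel satisfying an
isoperimetric inequality of order `d`. -/
lemma nash_step {V : Type*} {p : V → V → ℝ} {m : V → ℝ} {W : Finset V} {γ d κ L : ℝ}
    (hd : 1 < d) (hp : ∀ x y, 0 ≤ p x y) (hsym : ∀ x y, p x y = p y x)
    (hm : ∀ x ∈ W, ∑ y ∈ W, p x y ≤ m x) (hγ : 0 < γ) (hγ2 : γ ≤ 1 / 2)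
    (hlazy : ∀ x, γ * m x ≤ p x x) (hκ : 0 ≤ κ)
    (hiso : ∀ A : Finset V, κ * (∑ x ∈ A, m x) ^ ((d - 1) / d)
      ≤ ∑ x ∈ A, m x - ∑ x ∈ A, ∑ y ∈ A, p x y)
    {f : V → ℝ} (hf : ∀ x ∈ W, 0 ≤ f x) (hL : 0 < L) (hfL : ∑ x ∈ W, m x * f x ≤ L) :
    ∑ x ∈ W, (∑ y ∈ W, p x y * f y) ^ 2 / m x
      ≤ (∑ x ∈ W, m x * f x ^ 2) *
        (1 - γ / 2 * 4 ^ (-(2 / d)) * (κ ^ 2 * ((∑ x ∈ W, m x * f x ^ 2) / L ^ 2) ^ (2 / d))) := by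
  classical
  set Z := ∑ x ∈ W, m x * f x ^ 2 with hZdef
  have hm0 : ∀ x ∈ W, 0 ≤ m x := fun x hx =>
    (Finset.sum_nonneg fun y _ => hp x y).trans (hm x hx)
  have hd0 : 0 < d := by linarith
  have hcon := sum_sq_div_le hp hsym hm hγ.le hγ2 hlazy f
  have hZ0 : 0 ≤ Z := Finset.sum_nonneg fun x hx => mul_nonneg (hm0 x hx) (sq_nonneg _)
  rcases hZ0.eq_or_lt with hZ | hZ
  · have h1 : ∑ x ∈ W, ∑ y ∈ W, p x y * (f x * f y) ≤ Z := by
      refine le_trans (Finset.sum_le_sum fun x _ => Finset.sum_le_sum fun y _ => ?_)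
        (sum_mul_half_add_le hsym hm (v := fun x => f x ^ 2) fun x _ => sq_nonneg _)
      exact mul_le_mul_of_nonneg_left (by nlinarith [sq_nonneg (f x - f y)]) (hp x y)
    rw [← hZdef, ← hZ] at hcon
    rw [← hZ] at h1
    rw [← hZ, zero_mul]
    nlinarith
  set b := Z / (4 * L) with hb
  have hb0 : 0 < b := by positivity
  set g : V → ℝ := fun x => max (f x - b) 0 with hg
  set S := W.filter fun x => b < f x with hS
  have hSW : S ⊆ W := Finset.filter_subset _ _
  have hgS : ∀ x ∈ W, x ∉ S → g x = 0 := by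
    intro x hx hxS
    have : ¬ b < f x := fun h => hxS (Finset.mem_filter.2 ⟨hx, h⟩)
    exact max_eq_right (by linarith)
  set T := 4 * L ^ 2 / Z with hT
  have hT0 : 0 < T := by positivity
  have hbT : b * T = L := by rw [hb, hT]; field_simp
  have hST : ∑ x ∈ S, m x ≤ T := by
    have h1 : b * ∑ x ∈ S, m x ≤ ∑ x ∈ W, m x * f x := by
      rw [Finset.mul_sum]
      refine le_trans (Finset.sum_le_sum fun x hx => ?_)
        (Finset.sum_le_sum_of_subset_of_nonneg hSW
          fun x hx _ => mul_nonneg (hm0 x hx) (hf x hx))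
      rw [mul_comm]
      exact mul_le_mul_of_nonneg_left (Finset.mem_filter.1 hx).2.le (hm0 x (hSW hx))
    have h2 : b * ∑ x ∈ S, m x ≤ b * T := by rw [hbT]; exact h1.trans hfL
    exact le_of_mul_le_mul_left h2 hb0
  set φ := κ * T ^ (-(1 / d)) with hφ
  have hφ0 : 0 ≤ φ := by positivity
  have hA : ∀ A ⊆ S, ∑ x ∈ A, ∑ y ∈ A, p x y ≤ (1 - φ) * ∑ x ∈ A, m x := by
    intro A hAS
    have hA0 : 0 ≤ ∑ x ∈ A, m x := Finset.sum_nonneg fun x hx => hm0 x (hSW (hAS hx))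
    have hAT : ∑ x ∈ A, m x ≤ T :=
      (Finset.sum_le_sum_of_subset_of_nonneg hAS fun x hx _ => hm0 x (hSW hx)).trans hST
    have h1 := hiso A
    have h2 : T ^ (-(1 / d)) * ∑ x ∈ A, m x ≤ (∑ x ∈ A, m x) ^ ((d - 1) / d) := by
      rcases hA0.eq_or_lt with h | h
      · rw [← h, mul_zero]
        exact Real.rpow_nonneg le_rfl _
      · have e : (d - 1) / d = -(1 / d) + 1 := by field_simp; ring
        rw [e, Real.rpow_add h, Real.rpow_one]
        refine mul_le_mul_of_nonneg_right ?_ hA0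
        exact Real.rpow_le_rpow_of_nonpos h hAT (by
          have : 0 < 1 / d := by positivity
          linarith)
    have h3 := mul_le_mul_of_nonneg_left h2 hκ
    rw [← mul_assoc, ← hφ] at h3
    linarith
  have hgW : ∑ x ∈ W, m x * g x ^ 2 = ∑ x ∈ S, m x * g x ^ 2 :=
    (Finset.sum_subset hSW fun x hx hxS => by rw [hgS x hx hxS]; simp).symm
  have hgWW : ∑ x ∈ W, ∑ y ∈ W, p x y * (g x * g y)
      = ∑ x ∈ S, ∑ y ∈ S, p x y * (g x * g y) := by
    rw [← Finset.sum_subset hSW]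
    · refine Finset.sum_congr rfl fun x _ => (Finset.sum_subset hSW fun y hy hyS => ?_).symm
      rw [hgS y hy hyS]; simp
    · intro x hx hxS
      refine Finset.sum_eq_zero fun y _ => ?_
      rw [hgS x hx hxS]; simp
  have hgZ : Z / 2 ≤ ∑ x ∈ W, m x * g x ^ 2 := by
    have h1 : Z - 2 * b * ∑ x ∈ W, m x * f x ≤ ∑ x ∈ W, m x * g x ^ 2 := by
      rw [hZdef, Finset.mul_sum, ← Finset.sum_sub_distrib]
      refine Finset.sum_le_sum fun x hx => ?_
      have h2 : f x ^ 2 - 2 * b * f x ≤ g x ^ 2 := by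
        rcases le_total (f x) b with h | h
        · nlinarith [hf x hx, sq_nonneg (g x)]
        · have : g x = f x - b := max_eq_left (by linarith)
          rw [this]; nlinarith
      nlinarith [mul_le_mul_of_nonneg_left h2 (hm0 x hx)]
    have h2 : b * ∑ x ∈ W, m x * f x ≤ b * L := mul_le_mul_of_nonneg_left hfL hb0.le
    have h3 : b * L = Z / 4 := by rw [hb]; field_simp
    linarith
  have hφ1 : φ < 1 := by
    have hpos : 0 < ∑ x ∈ S, m x * g x ^ 2 := by rw [← hgW]; linarith
    obtain ⟨x, hx, hxpos⟩ := Finset.exists_lt_of_sum_lt (s := S) (f := fun _ => (0 : ℝ))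
      (by simpa using hpos)
    have hmx : 0 < m x := by
      rcases (hm0 x (hSW hx)).eq_or_lt with h | h
      · rw [← h, zero_mul] at hxpos
        exact absurd hxpos (lt_irrefl _)
      · exact h
    have h1 := hA {x} (by simpa using hx)
    simp only [Finset.sum_singleton] at h1
    have h2 := hlazy x
    have h3 : 0 < γ * m x := mul_pos hγ hmx
    by_contra hcon
    push Not at hcon
    nlinarith
  have hch := cheeger hp hsym (S := S) (m := m)
    (fun x hx => (Finset.sum_le_sum_of_subset_of_nonneg hSW fun y _ _ => hp x y).trans
      (hm x (hSW hx))) hφ0 hφ1 hA g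
  have htr := sum_mul_truncation_le hp hsym hm hf hb0.le
  have hsub : ∑ x ∈ W, m x * (f x ^ 2 - max (f x - b) 0 ^ 2)
      = Z - ∑ x ∈ W, m x * g x ^ 2 := by
    rw [hZdef, ← Finset.sum_sub_distrib]
    exact Finset.sum_congr rfl fun x _ => by simp only [hg]; ring
  rw [hsub] at htr
  rw [← hgW, ← hgWW] at hch
  have hR : ∑ x ∈ W, ∑ y ∈ W, p x y * (f x * f y) ≤ Z - φ ^ 2 / 2 * (Z / 2) := by
    have := mul_le_mul_of_nonneg_left hgZ (by positivity : 0 ≤ φ ^ 2 / 2)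
    have h' : ∑ x ∈ W, ∑ y ∈ W, p x y * (max (f x - b) 0 * max (f y - b) 0)
      = ∑ x ∈ W, ∑ y ∈ W, p x y * (g x * g y) := rfl
    linarith
  have hφ2 : φ ^ 2 = 4 ^ (-(2 / d)) * (κ ^ 2 * (Z / L ^ 2) ^ (2 / d)) := by
    have e1 : T = 4 * (Z / L ^ 2)⁻¹ := by rw [hT]; field_simp
    have e2 : (T ^ (-(1 / d))) ^ 2 = T ^ (-(2 / d)) := by
      rw [← Real.rpow_natCast, ← Real.rpow_mul hT0.le]
      congr 1; push_cast; ring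
    rw [hφ, mul_pow, e2, e1, Real.mul_rpow (by norm_num) (by positivity),
      Real.inv_rpow (by positivity), Real.rpow_neg (by positivity : 0 ≤ Z / L ^ 2), inv_inv]
    ring
  have hfin := mul_le_mul_of_nonneg_left hR (by linarith : 0 ≤ 2 * γ)
  have e : γ / 2 * 4 ^ (-(2 / d)) * (κ ^ 2 * (Z / L ^ 2) ^ (2 / d)) = γ / 2 * φ ^ 2 := by
    rw [hφ2]; ring
  rw [e]
  nlinarith

/-- A sequence with Nash-type decay decays polynomially. -/
lemma le_rpow_of_nash_decay {d c : ℝ} (hd : 0 < d) (hc : 0 < c) {e y a : ℕ → ℝ} {n : ℕ}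
    (ha : ∀ k, 0 ≤ a k) (hy : ∀ k < n, 0 ≤ y k) (hye : ∀ k < n, y k ≤ e k)
    (hstep : ∀ k < n, e (k + 1) ≤ y k * (1 - c * (a k * y k ^ (2 / d))))
    (hsum : 0 < ∑ k ∈ Finset.range n, a k) :
    e n ≤ (2 * c / d * ∑ k ∈ Finset.range n, a k) ^ (-(d / 2)) := by
  have main : ∀ k ≤ n, 0 < e k → 2 * c / d * ∑ i ∈ Finset.range k, a i ≤ e k ^ (-(2 / d)) := by
    intro k
    induction k with
    | zero => intro _ h; simpa using Real.rpow_nonneg h.le _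
    | succ k ih =>
      intro hk hek
      have hkn : k < n := hk
      have hy0 : 0 < y k := by
        rcases (hy k hkn).eq_or_lt with h | h
        · have := hstep k hkn
          rw [← h, zero_mul] at this
          exact absurd this (not_le.2 hek)
        · exact h
      have he0 : 0 < e k := hy0.trans_le (hye k hkn)
      have h1 := ih hkn.le he0
      have h2 : e k ^ (-(2 / d)) ≤ y k ^ (-(2 / d)) :=
        Real.rpow_le_rpow_of_nonpos hy0 (hye k hkn) (by
          have : 0 < 2 / d := by positivity
          linarith)
      set X := c * (a k * y k ^ (2 / d)) with hX
      have hX0 : 0 ≤ X := by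
        have := ha k
        positivity
      have h3 := hstep k hkn
      have h4 : 0 < 1 - X := by
        by_contra hcon
        push Not at hcon
        nlinarith
      have h5 : y k ^ (-(2 / d)) * (1 - X) ^ (-(2 / d)) ≤ e (k + 1) ^ (-(2 / d)) := by
        rw [← Real.mul_rpow hy0.le h4.le]
        exact Real.rpow_le_rpow_of_nonpos hek h3 (by
          have : 0 < 2 / d := by positivity
          linarith)
      have h6 : 1 + 2 / d * X ≤ (1 - X) ^ (-(2 / d)) := by
        have hl : Real.log (1 - X) ≤ -X := by
          have := Real.log_le_sub_one_of_pos h4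
          linarith
        rw [Real.rpow_def_of_pos h4]
        have hexp := Real.add_one_le_exp (Real.log (1 - X) * -(2 / d))
        have : 0 < 2 / d := by positivity
        nlinarith
      have h7 : y k ^ (-(2 / d)) * X = c * a k := by
        have : y k ^ (-(2 / d)) * y k ^ (2 / d) = 1 := by
          rw [← Real.rpow_add hy0]; simp
        rw [hX]; linear_combination c * a k * this
      have h8 := mul_le_mul_of_nonneg_left h6 (Real.rpow_nonneg hy0.le (-(2 / d)))
      have h9 : y k ^ (-(2 / d)) * (1 + 2 / d * X) = y k ^ (-(2 / d)) + 2 * c / d * a k := by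
        linear_combination 2 / d * h7
      rw [Finset.sum_range_succ, mul_add]
      linarith
  have hpos : 0 < 2 * c / d * ∑ k ∈ Finset.range n, a k := by positivity
  rcases le_or_gt (e n) 0 with h | h
  · exact h.trans (Real.rpow_nonneg hpos.le _)
  · have h1 := main n le_rfl h
    have h2 := Real.rpow_le_rpow_of_nonpos hpos h1 (by linarith : -(d / 2) ≤ 0)
    rw [← Real.rpow_mul h.le] at h2
    have : -(2 / d) * -(d / 2) = 1 := by field_simp
    rwa [this, Real.rpow_one] at h2

lemma mul_div_le_self_of_nonneg {a b : ℝ} (hb : 0 ≤ b) : a * (b / a) ≤ b := by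
  rcases eq_or_ne a 0 with h | h
  · simpa [h] using hb
  · rw [mul_div_cancel₀ _ h]

section Walk

variable {V : Type} {π : ℕ → V → V → ℝ}

lemma summable_conductance (hfin : ∀ t x, {y | π t x y ≠ 0}.Finite) (t : ℕ) (x : V) :
    Summable (π t x) :=
  summable_of_hasFiniteSupport (hfin t x)

lemma sum_le_vc (hp : ∀ t x y, 0 ≤ π t x y) (hfin : ∀ t x, {y | π t x y ≠ 0}.Finite)
    (t : ℕ) (x : V) (W : Finset V) : ∑ y ∈ W, π t x y ≤ vc π t x :=
  (summable_conductance hfin t x).sum_le_tsum W fun y _ => hp t x y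

lemma vc_nonneg (hp : ∀ t x y, 0 ≤ π t x y) (t : ℕ) (x : V) : 0 ≤ vc π t x :=
  tsum_nonneg (hp t x)

lemma le_vc (hp : ∀ t x y, 0 ≤ π t x y) (hfin : ∀ t x, {y | π t x y ≠ 0}.Finite)
    (t : ℕ) (x y : V) : π t x y ≤ vc π t x := by
  simpa using sum_le_vc hp hfin t x {y}

lemma eq_zero_of_vc_eq_zero (hp : ∀ t x y, 0 ≤ π t x y)
    (hfin : ∀ t x, {y | π t x y ≠ 0}.Finite) {t : ℕ} {x : V} (h : vc π t x = 0) (y : V) :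
    π t x y = 0 :=
  le_antisymm (h ▸ le_vc hp hfin t x y) (hp t x y)

lemma fCut_eq (hfin : ∀ t x, {y | π t x y ≠ 0}.Finite) (t : ℕ) (A : Finset V) :
    fCut π t A = ∑ a ∈ A, vc π t a - ∑ a ∈ A, ∑ b ∈ A, π t a b := by
  classical
  rw [fCut, ← Finset.sum_sub_distrib]
  refine Finset.sum_congr rfl fun a _ => ?_
  have h1 : ∑' b, (if b ∈ A then π t a b else 0) = ∑ b ∈ A, π t a b := by
    rw [tsum_eq_sum (s := A) fun b hb => if_neg hb]
    exact Finset.sum_congr rfl fun b hb => if_pos hb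
  have h2 : Summable fun b => if b ∈ A then π t a b else 0 :=
    summable_of_ne_finset_zero (s := A) fun b hb => if_neg hb
  rw [vc, ← h1, ← (summable_conductance hfin t a).tsum_sub h2]
  refine tsum_congr fun b => ?_
  by_cases hb : b ∈ A <;> simp [hb]

lemma isoperimetric_ratio_nonneg (hp : ∀ t x y, 0 ≤ π t x y) (d : ℝ) (t : ℕ) (A : Finset V) :
    0 ≤ fCut π t A / fMass π t A ^ ((d - 1) / d) := by
  refine div_nonneg (Finset.sum_nonneg fun a _ => tsum_nonneg fun b => ?_)
    (Real.rpow_nonneg (Finset.sum_nonneg fun a _ => vc_nonneg hp t a) _)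
  split_ifs
  · exact le_rfl
  · exact hp t a b

lemma kappa_nonneg (hp : ∀ t x y, 0 ≤ π t x y) (d : ℝ) (t : ℕ) : 0 ≤ kappa π d t := by
  refine Real.sInf_nonneg ?_
  rintro r ⟨A, -, -, rfl⟩
  exact isoperimetric_ratio_nonneg hp d t A

lemma kappa_mul_le (hp : ∀ t x y, 0 ≤ π t x y) (hsym : ∀ t x y, π t x y = π t y x)
    (hfin : ∀ t x, {y | π t x y ≠ 0}.Finite) {d : ℝ} (hd : 1 < d) (t : ℕ) (A : Finset V) :
    kappa π d t * (∑ a ∈ A, vc π t a) ^ ((d - 1) / d)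
      ≤ ∑ a ∈ A, vc π t a - ∑ a ∈ A, ∑ b ∈ A, π t a b := by
  classical
  set A' := A.filter fun a => 0 < vc π t a with hA'
  have hsub : A' ⊆ A := Finset.filter_subset _ _
  have hz : ∀ a ∈ A, a ∉ A' → vc π t a = 0 := fun a ha ha' =>
    le_antisymm (not_lt.1 fun h => ha' (Finset.mem_filter.2 ⟨ha, h⟩)) (vc_nonneg hp t a)
  have h1 : ∑ a ∈ A, vc π t a = ∑ a ∈ A', vc π t a := (Finset.sum_subset hsub hz).symm
  have h2 : ∑ a ∈ A, ∑ b ∈ A, π t a b = ∑ a ∈ A', ∑ b ∈ A', π t a b := by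
    rw [← Finset.sum_subset hsub]
    · refine Finset.sum_congr rfl fun a _ => (Finset.sum_subset hsub fun b hb hb' => ?_).symm
      rw [hsym, eq_zero_of_vc_eq_zero hp hfin (hz b hb hb')]
    · exact fun a ha ha' => Finset.sum_eq_zero fun b _ =>
        eq_zero_of_vc_eq_zero hp hfin (hz a ha ha') b
  rw [h1, h2]
  rcases A'.eq_empty_or_nonempty with h | hne
  · rw [h]
    have : (d - 1) / d ≠ 0 := (div_pos (by linarith) (by linarith)).ne'
    simp [Real.zero_rpow this]
  · have hpos : ∀ a ∈ A', 0 < vc π t a := fun a ha => (Finset.mem_filter.1 ha).2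
    have hm : 0 < ∑ a ∈ A', vc π t a := Finset.sum_pos hpos hne
    rw [← fCut_eq hfin, ← le_div_iff₀ (Real.rpow_pos_of_pos hm _)]
    refine csInf_le ⟨0, ?_⟩ ⟨A', hne, hpos, rfl⟩
    rintro r ⟨B, -, -, rfl⟩
    exact isoperimetric_ratio_nonneg hp d t B

lemma step_nonneg (hp : ∀ t x y, 0 ≤ π t x y) (t : ℕ) (x y : V) : 0 ≤ step π t x y :=
  div_nonneg (hp t x y) (vc_nonneg hp t x)

lemma sum_step_le_one (hp : ∀ t x y, 0 ≤ π t x y) (hfin : ∀ t x, {y | π t x y ≠ 0}.Finite)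
    (t : ℕ) (x : V) (W : Finset V) : ∑ y ∈ W, step π t x y ≤ 1 := by
  simp only [step, ← Finset.sum_div]
  exact div_le_one_of_le₀ (sum_le_vc hp hfin t x W) (vc_nonneg hp t x)

lemma Pn_nonneg (hp : ∀ t x y, 0 ≤ π t x y) (s n : ℕ) (x y : V) : 0 ≤ Pn π s n x y := by
  classical
  induction n generalizing y with
  | zero => simp only [Pn]; split_ifs <;> norm_num
  | succ n ih =>
    exact tsum_nonneg fun z => mul_nonneg (ih z) (step_nonneg hp _ _ _)

lemma Pn_support_finite (hfin : ∀ t x, {y | π t x y ≠ 0}.Finite) (s n : ℕ) (x : V) :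
    {y | Pn π s n x y ≠ 0}.Finite := by
  classical
  induction n with
  | zero =>
    refine (Set.finite_singleton x).subset fun y hy => ?_
    by_contra h
    exact hy (if_neg fun h' => h h'.symm)
  | succ n ih =>
    refine (ih.biUnion fun z _ => hfin (s + n) z).subset fun y hy => ?_
    obtain ⟨z, hz⟩ : ∃ z, Pn π s n x z * step π (s + n) z y ≠ 0 := by
      by_contra! h
      exact hy ((tsum_congr h).trans tsum_zero)
    refine Set.mem_biUnion (x := z) (left_ne_zero_of_mul hz) ?_
    intro h
    exact right_ne_zero_of_mul hz (by rw [step, h, zero_div])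

lemma exists_finset_support (hfin : ∀ t x, {y | π t x y ≠ 0}.Finite) (s n : ℕ) (x y : V) :
    ∃ W : Finset V, y ∈ W ∧ ∀ k ≤ n, ∀ z ∉ W, Pn π s k x z = 0 := by
  classical
  refine ⟨insert y ((Finset.range (n + 1)).biUnion fun k =>
    (Pn_support_finite hfin s k x).toFinset), by simp, fun k hk z hz => ?_⟩
  by_contra h
  refine hz (Finset.mem_insert_of_mem (Finset.mem_biUnion.2 ⟨k, by simp; omega, by simpa using h⟩))

lemma Pn_succ_eq_sum {s k : ℕ} {x : V} {W : Finset V} (hW : ∀ z ∉ W, Pn π s k x z = 0) (y : V) :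
    Pn π s (k + 1) x y = ∑ z ∈ W, Pn π s k x z * step π (s + k) z y :=
  tsum_eq_sum fun z hz => by rw [hW z hz, zero_mul]

lemma ratioSet_sSup_nonneg (hp : ∀ t x y, 0 ≤ π t x y) (u : ℕ) : 0 ≤ sSup (ratioSet π u) := by
  refine Real.sSup_nonneg ?_
  rintro r ⟨x, -, rfl⟩
  exact div_nonneg (vc_nonneg hp _ _) (vc_nonneg hp _ _)

lemma vc_le_sSup_mul (hp : ∀ t x y, 0 ≤ π t x y) {u : ℕ} (hbdd : BddAbove (ratioSet π u))
    {x : V} (hx : 0 < vc π (u + 1) x) :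
    vc π u x ≤ sSup (ratioSet π u) * vc π (u + 1) x := by
  rcases (vc_nonneg hp u x).eq_or_lt with h | h
  · rw [← h]
    exact mul_nonneg (ratioSet_sSup_nonneg hp u) hx.le
  · rw [← div_le_iff₀ hx]
    exact le_csSup hbdd ⟨x, h, rfl⟩

lemma sum_Pn_le_one (hp : ∀ t x y, 0 ≤ π t x y) (hfin : ∀ t x, {y | π t x y ≠ 0}.Finite)
    {s n : ℕ} {x : V} {W : Finset V} (hW : ∀ k ≤ n, ∀ z ∉ W, Pn π s k x z = 0) :
    ∀ k ≤ n, ∑ z ∈ W, Pn π s k x z ≤ 1 := by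
  classical
  intro k
  induction k with
  | zero =>
    intro _
    simp only [Pn, Finset.sum_ite_eq]
    split_ifs <;> norm_num
  | succ k ih =>
    intro hk
    rw [Finset.sum_congr rfl fun y _ => Pn_succ_eq_sum (hW k (by omega)) y, Finset.sum_comm]
    refine le_trans (Finset.sum_le_sum fun z _ => ?_) (ih (by omega))
    rw [← Finset.mul_sum]
    exact mul_le_of_le_one_right (Pn_nonneg hp s k x z) (sum_step_le_one hp hfin _ z W)

/-- The forward evolution in terms of the density `P / π`. -/
lemma Pn_succ_eq_sum_density (hsym : ∀ t x y, π t x y = π t y x)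
    {s k : ℕ} {x : V} {W : Finset V} (hW : ∀ z ∉ W, Pn π s k x z = 0) (y : V) :
    Pn π s (k + 1) x y = ∑ z ∈ W, π (s + k) y z * (Pn π s k x z / vc π (s + k) z) := by
  rw [Pn_succ_eq_sum hW]
  refine Finset.sum_congr rfl fun z _ => ?_
  rw [step, hsym (s + k) z y]
  ring

open Classical in
/-- The backward evolution, restricted to `W`, of the heat kernel with endpoint `y` at time `t`,
after `k` steps. -/
def backward (π : ℕ → V → V → ℝ) (W : Finset V) (t : ℕ) (y : V) : ℕ → V → ℝ
  | 0 => fun z => if z = y then (vc π t y)⁻¹ else 0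
  | k + 1 => fun x => ∑ z ∈ W, step π (t - (k + 1)) x z * backward π W t y k z

lemma backward_nonneg (hp : ∀ t x y, 0 ≤ π t x y) (W : Finset V) (t : ℕ) (y : V) (k : ℕ) (x : V) :
    0 ≤ backward π W t y k x := by
  classical
  induction k generalizing x with
  | zero =>
    simp only [backward]
    split_ifs
    · exact inv_nonneg.2 (vc_nonneg hp t y)
    · exact le_rfl
  | succ k ih =>
    exact Finset.sum_nonneg fun z _ => mul_nonneg (step_nonneg hp _ _ _) (ih z)

lemma backward_succ_eq (W : Finset V) (t : ℕ) (y : V) (k : ℕ) (x : V) :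
    backward π W t y (k + 1) x
      = (∑ z ∈ W, π (t - (k + 1)) x z * backward π W t y k z) / vc π (t - (k + 1)) x := by
  rw [backward, Finset.sum_div]
  exact Finset.sum_congr rfl fun z _ => by rw [step]; ring

lemma backward_eq_zero {W : Finset V} {t : ℕ} {y : V} (hy : 0 < vc π t y) {k : ℕ}
    {x : V} (hx : vc π (t - k) x = 0) : backward π W t y k x = 0 := by
  classical
  cases k with
  | zero =>
    refine if_neg ?_
    rintro rfl
    exact hy.ne' hx
  | succ k => rw [backward_succ_eq, hx, div_zero]

/-- Duality between the forward and the backward evolutions. -/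
lemma hk_eq_sum {s t : ℕ} {x y : V} {W : Finset V} (hyW : y ∈ W)
    (hW : ∀ k ≤ t - s, ∀ z ∉ W, Pn π s k x z = 0) :
    ∀ k ≤ t - s, hk π s t x y = ∑ z ∈ W, Pn π s (t - s - k) x z * backward π W t y k z := by
  classical
  intro k
  induction k with
  | zero =>
    intro _
    simp [backward, hk, hyW, div_eq_mul_inv]
  | succ k ih =>
    intro hk
    rw [ih (by omega)]
    obtain ⟨j, hj⟩ : ∃ j, t - s - (k + 1) = j := ⟨_, rfl⟩
    have e1 : t - s - k = j + 1 := by omega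
    have e2 : t - (k + 1) = s + j := by omega
    rw [hj, e1]
    simp only [Pn_succ_eq_sum (hW j (by omega)), backward, e2, Finset.sum_mul, Finset.mul_sum]
    rw [Finset.sum_comm]
    exact Finset.sum_congr rfl fun z _ => Finset.sum_congr rfl fun w _ => by ring

section Decay

variable {d γ : ℝ} {β : ℕ → ℝ}

lemma beta_nonneg (hp : ∀ t x y, 0 ≤ π t x y) (hβ0 : β 0 = 1)
    (hβ : ∀ u, β (u + 1) = β u * sSup (ratioSet π u)) (u : ℕ) : 0 ≤ β u := by
  induction u with
  | zero => rw [hβ0]; norm_num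
  | succ u ih => rw [hβ]; exact mul_nonneg ih (ratioSet_sSup_nonneg hp u)

lemma beta_eq_zero_of_le (hβ : ∀ u, β (u + 1) = β u * sSup (ratioSet π u)) {u v : ℕ} (huv : u ≤ v)
    (hu : β u = 0) : β v = 0 := by
  induction v, huv using Nat.le_induction with
  | base => exact hu
  | succ v _ ih => rw [hβ, ih, zero_mul]

lemma sq_mul_rpow_eq {b κ q : ℝ} (hb : 0 ≤ b) (hq : 0 ≤ q) :
    κ ^ 2 * (b * q) ^ (2 / d) = (b ^ (1 / d) * κ) ^ 2 * q ^ (2 / d) := by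
  have : (b ^ (1 / d)) ^ 2 = b ^ (2 / d) := by
    rw [← Real.rpow_natCast, ← Real.rpow_mul hb]
    congr 1; push_cast; ring
  rw [mul_pow, this, Real.mul_rpow hb hq]
  ring

lemma psiB_sub (π : ℕ → V → V → ℝ) (β : ℕ → ℝ) (d : ℝ) (s n : ℕ) :
    psiB π β d (s + n) - psiB π β d s
      = ∑ k ∈ Finset.range n, (β (s + k) ^ (1 / d) * kappa π d (s + k)) ^ 2 := by
  rw [psiB, psiB, Finset.sum_range_add, add_sub_cancel_left]

/-- Decay of the `L²` norm of the forward density. -/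
lemma forward_decay (hd : 1 < d) (hγ : 0 < γ) (hγ2 : γ ≤ 1 / 2)
    (hp : ∀ t x y, 0 ≤ π t x y) (hsym : ∀ t x y, π t x y = π t y x)
    (hfin : ∀ t x, {y | π t x y ≠ 0}.Finite) (hlazy : ∀ t x, γ * vc π t x ≤ π t x x)
    (hbdd : ∀ u, BddAbove (ratioSet π u))
    (hβ : ∀ u, β (u + 1) = β u * sSup (ratioSet π u))
    {s n : ℕ} {x : V} {W : Finset V} (hW : ∀ k ≤ n, ∀ z ∉ W, Pn π s k x z = 0)
    (hβpos : ∀ k ≤ n, 0 < β (s + k))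
    (hsum : 0 < psiB π β d (s + n) - psiB π β d s) :
    ∑ z ∈ W, Pn π s n x z ^ 2 / vc π (s + n) z
      ≤ β (s + n) * (2 * (γ / 2 * 4 ^ (-(2 / d))) / d *
        (psiB π β d (s + n) - psiB π β d s)) ^ (-(d / 2)) := by
  have hd0 : 0 < d := by linarith
  set e : ℕ → ℝ := fun k => (∑ z ∈ W, Pn π s k x z ^ 2 / vc π (s + k) z) / β (s + k) with he
  have hN0 : ∀ k, 0 ≤ ∑ z ∈ W, Pn π s k x z ^ 2 / vc π (s + k) z := fun k =>
    Finset.sum_nonneg fun z _ => div_nonneg (sq_nonneg _) (vc_nonneg hp _ _)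
  have hZ : ∀ k, ∑ z ∈ W, vc π (s + k) z * (Pn π s k x z / vc π (s + k) z) ^ 2
      = ∑ z ∈ W, Pn π s k x z ^ 2 / vc π (s + k) z := by
    intro k
    refine Finset.sum_congr rfl fun z _ => ?_
    rcases eq_or_ne (vc π (s + k) z) 0 with h | h
    · simp [h]
    · field_simp
  have hmain : ∀ k < n, e (k + 1) ≤
      (∑ y ∈ W, (∑ z ∈ W, π (s + k) y z * (Pn π s k x z / vc π (s + k) z)) ^ 2
        / vc π (s + k) y) / β (s + k) := by
    intro k hk
    have hb := hβpos k hk.le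
    have hb' := hβpos (k + 1) hk
    have hρ : 0 < sSup (ratioSet π (s + k)) := by
      have h1 := hβ (s + k)
      rw [← add_assoc, h1] at hb'
      exact pos_of_mul_pos_right hb' hb.le
    simp only [he]
    rw [← add_assoc, hβ (s + k), div_le_div_iff₀ (by positivity) hb, mul_comm (β (s + k)),
      ← mul_assoc]
    refine mul_le_mul_of_nonneg_right ?_ hb.le
    rw [Finset.sum_mul]
    refine Finset.sum_le_sum fun y _ => ?_
    rw [← Pn_succ_eq_sum_density hsym (hW k hk.le) y]
    rcases (vc_nonneg hp (s + k + 1) y).eq_or_lt with h | h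
    · rw [← h, div_zero]
      exact mul_nonneg (div_nonneg (sq_nonneg _) (vc_nonneg hp _ _)) hρ.le
    rcases (vc_nonneg hp (s + k) y).eq_or_lt with h' | h'
    · have : Pn π s (k + 1) x y = 0 := by
        rw [Pn_succ_eq_sum_density hsym (hW k hk.le) y]
        exact Finset.sum_eq_zero fun z _ => by
          rw [eq_zero_of_vc_eq_zero hp hfin h'.symm, zero_mul]
      rw [this]; simp
    · rw [div_mul_eq_mul_div, div_le_div_iff₀ h h', mul_assoc]
      exact mul_le_mul_of_nonneg_left (vc_le_sSup_mul hp (hbdd _) h) (sq_nonneg _)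
  have key : e n ≤ _ := le_rpow_of_nash_decay (d := d) (c := γ / 2 * 4 ^ (-(2 / d))) hd0
    (by positivity) (e := e) (y := e) (n := n)
    (a := fun k => (β (s + k) ^ (1 / d) * kappa π d (s + k)) ^ 2)
    (fun k => sq_nonneg _) (fun k hk => div_nonneg (hN0 k) (hβpos k hk.le).le)
    (fun k _ => le_rfl) ?_ (by rwa [← psiB_sub])
  · rw [← psiB_sub] at key
    rwa [← div_le_iff₀' (hβpos n le_rfl)]
  · intro k hk
    have hb := hβpos k hk.le
    have hek : 0 ≤ e k := div_nonneg (hN0 k) hb.le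
    have hn := nash_step (p := π (s + k)) (m := vc π (s + k)) (W := W) (L := 1)
      (κ := kappa π d (s + k)) hd (hp _) (hsym _) (fun z _ => sum_le_vc hp hfin _ z W) hγ hγ2
      (hlazy _) (kappa_nonneg hp d _) (kappa_mul_le hp hsym hfin hd _)
      (f := fun z => Pn π s k x z / vc π (s + k) z)
      (fun z _ => div_nonneg (Pn_nonneg hp _ _ _ _) (vc_nonneg hp _ _)) one_pos
      (le_trans (Finset.sum_le_sum fun z _ => mul_div_le_self_of_nonneg
        (Pn_nonneg hp _ _ _ _)) (sum_Pn_le_one hp hfin hW k hk.le))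
    rw [hZ] at hn
    have hNe : ∑ z ∈ W, Pn π s k x z ^ 2 / vc π (s + k) z = β (s + k) * e k := by
      rw [he]; field_simp
    rw [hNe, one_pow, div_one, sq_mul_rpow_eq hb.le hek] at hn
    refine (hmain k hk).trans ?_
    rw [div_le_iff₀' hb, ← mul_assoc]
    exact hn
/-- Moving the time index of a nonnegative weight one step forward costs the factor in `β`. -/
lemma beta_mul_sum_le (hp : ∀ t x y, 0 ≤ π t x y) (hβ0 : β 0 = 1)
    (hβ : ∀ u, β (u + 1) = β u * sSup (ratioSet π u)) {u : ℕ}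
    (hbdd : BddAbove (ratioSet π u)) {W : Finset V} {v : V → ℝ} (hv : ∀ z, 0 ≤ v z)
    (hv0 : ∀ z, vc π (u + 1) z = 0 → v z = 0) :
    β u * ∑ z ∈ W, vc π u z * v z ≤ β (u + 1) * ∑ z ∈ W, vc π (u + 1) z * v z := by
  rw [hβ, mul_assoc]
  refine mul_le_mul_of_nonneg_left ?_ (beta_nonneg hp hβ0 hβ u)
  rw [Finset.mul_sum]
  refine Finset.sum_le_sum fun z _ => ?_
  rcases (vc_nonneg hp (u + 1) z).eq_or_lt with h | h
  · rw [hv0 z h.symm]; simp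
  · rw [← mul_assoc]
    exact mul_le_mul_of_nonneg_right (vc_le_sSup_mul hp hbdd h) (hv z)

/-- The weighted `L¹` norm of the backward evolution. -/
lemma beta_mul_sum_backward_le (hp : ∀ t x y, 0 ≤ π t x y) (hsym : ∀ t x y, π t x y = π t y x)
    (hfin : ∀ t x, {y | π t x y ≠ 0}.Finite)
    (hbdd : ∀ u, BddAbove (ratioSet π u)) (hβ0 : β 0 = 1)
    (hβ : ∀ u, β (u + 1) = β u * sSup (ratioSet π u))
    {t : ℕ} {y : V} (hy : 0 < vc π t y) (W : Finset V) :
    ∀ k ≤ t, β (t - k) * ∑ z ∈ W, vc π (t - k) z * backward π W t y k z ≤ β t := by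
  classical
  intro k
  induction k with
  | zero =>
    intro _
    refine mul_le_of_le_one_right (beta_nonneg hp hβ0 hβ _) ?_
    simp only [backward, mul_ite, mul_zero, Finset.sum_ite_eq']
    split_ifs
    · exact (mul_inv_cancel₀ hy.ne').le
    · norm_num
  | succ k ih =>
    intro hk
    obtain ⟨u, hu⟩ : ∃ u, t - (k + 1) = u := ⟨_, rfl⟩
    have hu1 : t - k = u + 1 := by omega
    have h1 : ∑ z ∈ W, vc π u z * backward π W t y (k + 1) z
        ≤ ∑ z ∈ W, vc π u z * backward π W t y k z := by
      calc _ ≤ ∑ x ∈ W, ∑ z ∈ W, π u x z * backward π W t y k z := by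
            refine Finset.sum_le_sum fun x _ => ?_
            rw [backward_succ_eq, hu]
            exact mul_div_le_self_of_nonneg (Finset.sum_nonneg fun z _ =>
              mul_nonneg (hp _ _ _) (backward_nonneg hp W t y k z))
        _ ≤ _ := by
            rw [Finset.sum_comm]
            refine Finset.sum_le_sum fun z _ => ?_
            rw [← Finset.sum_mul]
            refine mul_le_mul_of_nonneg_right ?_ (backward_nonneg hp W t y k z)
            rw [Finset.sum_congr rfl fun x _ => hsym u x z]
            exact sum_le_vc hp hfin u z W
    have h2 := beta_mul_sum_le (W := W) hp hβ0 hβ (hbdd u) (backward_nonneg hp W t y k)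
      fun z hz => backward_eq_zero hy (by rwa [hu1])
    have h3 := ih (by omega)
    rw [hu1] at h3
    rw [hu]
    exact (mul_le_mul_of_nonneg_left h1 (beta_nonneg hp hβ0 hβ u)).trans (h2.trans h3)

/-- Decay of the `L²` norm of the backward evolution. -/
lemma backward_decay (hd : 1 < d) (hγ : 0 < γ) (hγ2 : γ ≤ 1 / 2)
    (hp : ∀ t x y, 0 ≤ π t x y) (hsym : ∀ t x y, π t x y = π t y x)
    (hfin : ∀ t x, {y | π t x y ≠ 0}.Finite) (hlazy : ∀ t x, γ * vc π t x ≤ π t x x)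
    (hbdd : ∀ u, BddAbove (ratioSet π u)) (hβ0 : β 0 = 1)
    (hβ : ∀ u, β (u + 1) = β u * sSup (ratioSet π u))
    {r n : ℕ} {y : V} (hy : 0 < vc π (r + n) y) (W : Finset V) (hβpos : 0 < β (r + n))
    (hsum : 0 < psiB π β d (r + n) - psiB π β d r) :
    β r * ∑ z ∈ W, vc π r z * backward π W (r + n) y n z ^ 2
      ≤ β (r + n) ^ 2 * (2 * (γ / 2 * 4 ^ (-(2 / d))) / d *
        (psiB π β d (r + n) - psiB π β d r)) ^ (-(d / 2)) := by
  have hd0 : 0 < d := by linarith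
  obtain ⟨t, ht⟩ : ∃ t, r + n = t := ⟨_, rfl⟩
  have hpsi : psiB π β d t - psiB π β d r
      = ∑ k ∈ Finset.range n, (β (t - (k + 1)) ^ (1 / d) * kappa π d (t - (k + 1))) ^ 2 := by
    rw [← ht, psiB_sub, ← Finset.sum_range_reflect]
    refine Finset.sum_congr rfl fun k hk => ?_
    have hk' := Finset.mem_range.1 hk
    have : r + (n - 1 - k) = r + n - (k + 1) := by omega
    rw [this]
  have hr : r = t - n := by omega
  rw [ht] at hsum hy hβpos ⊢
  have hβp : ∀ u ≤ t, 0 < β u := fun u hu =>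
    (beta_nonneg hp hβ0 hβ u).lt_of_ne' fun h => hβpos.ne' (beta_eq_zero_of_le hβ hu h)
  set e : ℕ → ℝ := fun k =>
    β (t - k) * (∑ z ∈ W, vc π (t - k) z * backward π W t y k z ^ 2) / β t ^ 2 with he
  set q : ℕ → ℝ := fun k =>
    β (t - (k + 1)) * (∑ z ∈ W, vc π (t - (k + 1)) z * backward π W t y k z ^ 2) / β t ^ 2
    with hq
  have hq0 : ∀ k, 0 ≤ q k := fun k => div_nonneg (mul_nonneg (beta_nonneg hp hβ0 hβ _)
    (Finset.sum_nonneg fun z _ => mul_nonneg (vc_nonneg hp _ _) (sq_nonneg _))) (sq_nonneg _)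
  have key : e n ≤ _ := le_rpow_of_nash_decay (d := d) (c := γ / 2 * 4 ^ (-(2 / d))) hd0
    (by positivity) (e := e) (y := q) (n := n)
    (a := fun k => (β (t - (k + 1)) ^ (1 / d) * kappa π d (t - (k + 1))) ^ 2)
    (fun k => sq_nonneg _) (fun k _ => hq0 k) ?_ ?_ (by rwa [← hpsi])
  · rw [← hpsi] at key
    rw [← div_le_iff₀' (by positivity)]
    simpa only [he, ← hr] using key
  · intro k hk
    obtain ⟨u, hu⟩ : ∃ u, t - (k + 1) = u := ⟨_, rfl⟩
    have hu1 : t - k = u + 1 := by omega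
    simp only [he, hq]
    rw [hu, hu1]
    refine div_le_div_of_nonneg_right ?_ (sq_nonneg _)
    refine beta_mul_sum_le hp hβ0 hβ (hbdd u) (fun z => sq_nonneg _) fun z hz => ?_
    rw [backward_eq_zero hy (by rwa [hu1])]
    simp
  · intro k hk
    obtain ⟨u, hu⟩ : ∃ u, t - (k + 1) = u := ⟨_, rfl⟩
    have hu1 : t - k = u + 1 := by omega
    have hb := hβp u (by omega)
    have hL1 := beta_mul_sum_backward_le hp hsym hfin hbdd hβ0 hβ hy W k (by omega)
    rw [hu1] at hL1
    have hL2 := (beta_mul_sum_le (W := W) hp hβ0 hβ (hbdd u) (backward_nonneg hp W t y k)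
      fun z hz => backward_eq_zero hy (by rwa [hu1])).trans hL1
    have hn := nash_step (p := π u) (m := vc π u) (W := W) (L := β t / β u)
      (κ := kappa π d u) hd (hp _) (hsym _) (fun z _ => sum_le_vc hp hfin _ z W) hγ hγ2
      (hlazy _) (kappa_nonneg hp d _) (kappa_mul_le hp hsym hfin hd _)
      (f := backward π W t y k) (fun z _ => backward_nonneg hp W t y k z) (by positivity)
      (by rwa [le_div_iff₀' hb])
    have hqk : q k = β u * (∑ z ∈ W, vc π u z * backward π W t y k z ^ 2) / β t ^ 2 := by
      simp only [hq, hu]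
    have hZ : (∑ z ∈ W, vc π u z * backward π W t y k z ^ 2) / (β t / β u) ^ 2
        = β u * q k := by
      rw [hqk]; field_simp
    have hek : e (k + 1) = β u * (∑ x ∈ W, (∑ z ∈ W, π u x z * backward π W t y k z) ^ 2
        / vc π u x) / β t ^ 2 := by
      simp only [he, hu]
      congr 2
      refine Finset.sum_congr rfl fun x _ => ?_
      rw [backward_succ_eq, hu]
      rcases eq_or_ne (vc π u x) 0 with h | h
      · simp [h]
      · field_simp
    rw [hZ, sq_mul_rpow_eq hb.le (hq0 k)] at hn
    rw [hek, hu]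
    refine (div_le_div_of_nonneg_right (mul_le_mul_of_nonneg_left hn hb.le)
      (sq_nonneg (β t))).trans_eq ?_
    nth_rewrite 2 [hqk]
    ring

end Decay

end Walk

/-- **Theorem 1.2 (first part) of Dembo–Huang–Morris–Peres.** For a uniformly `γ`-lazy
time-varying conductance model with finite `β(u)`, under the balance condition
(existence of an intermediate time `r`), the heat kernel satisfies
`h(s,x;t,y) ≤ c₊ β(t) (ψ_{d,β}(t) − ψ_{d,β}(s))^{−d/2}`. -/
theorem heat_kernel_upper_bound_beta
    (d γ lam : ℝ) (hd : 1 < d) (hγ : γ ∈ Set.Ioc (0 : ℝ) (1 / 2))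
    (hlam : lam ∈ Set.Ioc (0 : ℝ) (1 / 2)) :
    ∃ c : ℝ, ∀ (V : Type) (_ : Countable V) (π : ℕ → V → V → ℝ) (β : ℕ → ℝ),
      (∀ t x y, 0 ≤ π t x y) →
      (∀ t x y, π t x y = π t y x) →
      (∀ t x, {y | π t x y ≠ 0}.Finite) →
      (∀ t x, γ * vc π t x ≤ π t x x) →
      β 0 = 1 →
      (∀ u, (ratioSet π u).Nonempty ∧ BddAbove (ratioSet π u)) →
      (∀ u, β (u + 1) = β u * sSup (ratioSet π u)) →
      ∀ s t : ℕ, s < t → ∀ x y : V, 0 < vc π s x → 0 < vc π t y →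
      (∃ r : ℕ, s < r ∧ r < t ∧
        lam ≤ (psiB π β d r - psiB π β d s) / (psiB π β d t - psiB π β d s) ∧
        (psiB π β d r - psiB π β d s) / (psiB π β d t - psiB π β d s) ≤ 1 - lam) →
      hk π s t x y ≤ c * β t * (psiB π β d t - psiB π β d s) ^ (-(d / 2)) := by
  obtain ⟨hγ0, hγ2⟩ := hγ
  obtain ⟨hlam0, -⟩ := hlam
  have hd0 : 0 < d := by linarith
  set C := 2 * (γ / 2 * (4 : ℝ) ^ (-(2 / d))) / d with hC
  have hC0 : 0 < C := by positivity
  refine ⟨(C * lam) ^ (-(d / 2)), ?_⟩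
  intro V _ π β hp hsym hfin hlazy hβ0 hratio hβ s t hst x y _ hy ⟨r, hsr, hrt, hr1, hr2⟩
  have hbdd := fun u => (hratio u).2
  obtain ⟨n, rfl⟩ := Nat.exists_eq_add_of_lt hsr
  obtain ⟨k, rfl⟩ := Nat.exists_eq_add_of_lt hrt
  rw [add_assoc s n 1] at hr1 hr2 hy ⊢
  generalize n + 1 = n at hr1 hr2 hy ⊢
  rw [add_assoc (s + n) k 1] at hr1 hr2 hy ⊢
  generalize k + 1 = k at hr1 hr2 hy ⊢
  have hΨ1 : 0 ≤ psiB π β d (s + n) - psiB π β d s := by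
    rw [psiB_sub]; exact Finset.sum_nonneg fun _ _ => sq_nonneg _
  have hΨ2 : 0 ≤ psiB π β d (s + n + k) - psiB π β d (s + n) := by
    rw [psiB_sub]; exact Finset.sum_nonneg fun _ _ => sq_nonneg _
  set Δ := psiB π β d (s + n + k) - psiB π β d s with hΔ
  have hΔ0 : 0 < Δ := by
    have h1 : 0 ≤ Δ := by rw [hΔ]; linarith
    refine h1.lt_of_ne' fun h => ?_
    rw [h, div_zero] at hr1
    linarith
  rw [le_div_iff₀ hΔ0] at hr1
  rw [div_le_iff₀ hΔ0] at hr2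
  have hr2' : lam * Δ ≤ psiB π β d (s + n + k) - psiB π β d (s + n) := by linarith
  have hlΔ : 0 < lam * Δ := mul_pos hlam0 hΔ0
  have hβr : 0 < β (s + n) := by
    refine (beta_nonneg hp hβ0 hβ _).lt_of_ne' fun h => ?_
    have : psiB π β d (s + n + k) - psiB π β d (s + n) = 0 := by
      rw [psiB_sub]
      refine Finset.sum_eq_zero fun i _ => ?_
      rw [beta_eq_zero_of_le hβ (Nat.le_add_right _ i) h,
        Real.zero_rpow (one_div_pos.2 hd0).ne']
      simp
    linarith
  obtain ⟨W, hyW, hW⟩ := exists_finset_support hfin s (n + k) x y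
  have hts : s + n + k - s = n + k := by omega
  have hdual := hk_eq_sum (π := π) (s := s) (t := s + n + k) (x := x) hyW
    (by rwa [hts]) k (by omega)
  rw [hts, Nat.add_sub_cancel] at hdual
  set G := backward π W (s + n + k) y k with hG
  have hG0 : ∀ z, 0 ≤ G z := backward_nonneg hp W _ y k
  have hGz : ∀ z, vc π (s + n) z = 0 → G z = 0 := fun z hz =>
    backward_eq_zero hy (by rwa [Nat.add_sub_cancel])
  rcases (beta_nonneg hp hβ0 hβ (s + n + k)).eq_or_lt with hB | hB
  · have h1 := beta_mul_sum_backward_le hp hsym hfin hbdd hβ0 hβ hy W k (by omega)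
    rw [Nat.add_sub_cancel, ← hB] at h1
    have h2 : ∑ z ∈ W, vc π (s + n) z * G z ≤ 0 := by
      by_contra hcon
      exact absurd (mul_pos hβr (not_le.1 hcon)) (not_lt.2 h1)
    have hnn : ∀ z ∈ W, 0 ≤ vc π (s + n) z * G z := fun z _ =>
      mul_nonneg (vc_nonneg hp _ z) (hG0 z)
    have h3 := (Finset.sum_eq_zero_iff_of_nonneg hnn).1 (le_antisymm h2 (Finset.sum_nonneg hnn))
    rw [← hB, mul_zero, zero_mul, hdual]
    refine (Finset.sum_eq_zero fun z hz => ?_).le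
    rcases mul_eq_zero.1 (h3 z hz) with h | h
    · rw [hGz z h, mul_zero]
    · rw [h, mul_zero]
  have hF := forward_decay hd hγ0 hγ2 hp hsym hfin hlazy hbdd hβ
    (fun i hi => hW i (by omega)) (fun i hi => (beta_nonneg hp hβ0 hβ _).lt_of_ne' fun h =>
      hβr.ne' (beta_eq_zero_of_le hβ (Nat.add_le_add_left hi s) h)) (hlΔ.trans_le hr1)
  have hM := backward_decay hd hγ0 hγ2 hp hsym hfin hlazy hbdd hβ0 hβ hy W hB
    (hlΔ.trans_le hr2')
  rw [← hC] at hF hM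
  rw [← hG] at hM
  set D := (C * (lam * Δ)) ^ (-(d / 2)) with hD
  have hD0 : 0 ≤ D := by positivity
  have hD1 : (C * (psiB π β d (s + n) - psiB π β d s)) ^ (-(d / 2)) ≤ D :=
    Real.rpow_le_rpow_of_nonpos (by positivity) (mul_le_mul_of_nonneg_left hr1 hC0.le)
      (by linarith)
  have hD2 : (C * (psiB π β d (s + n + k) - psiB π β d (s + n))) ^ (-(d / 2)) ≤ D :=
    Real.rpow_le_rpow_of_nonpos (by positivity) (mul_le_mul_of_nonneg_left hr2' hC0.le)
      (by linarith)
  have hF' := hF.trans (mul_le_mul_of_nonneg_left hD1 hβr.le)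
  have hM' := hM.trans (mul_le_mul_of_nonneg_left hD2 (sq_nonneg (β (s + n + k))))
  have hM0 : 0 ≤ ∑ z ∈ W, vc π (s + n) z * G z ^ 2 :=
    Finset.sum_nonneg fun z _ => mul_nonneg (vc_nonneg hp _ z) (sq_nonneg _)
  have hCS : hk π s (s + n + k) x y ^ 2
      ≤ (∑ z ∈ W, Pn π s n x z ^ 2 / vc π (s + n) z) * ∑ z ∈ W, vc π (s + n) z * G z ^ 2 := by
    rw [hdual]
    refine Finset.sum_sq_le_sum_mul_sum_of_sq_le_mul W
      (fun z _ => div_nonneg (sq_nonneg _) (vc_nonneg hp _ _))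
      (fun z _ => mul_nonneg (vc_nonneg hp _ _) (sq_nonneg _)) fun z _ => ?_
    rcases eq_or_ne (vc π (s + n) z) 0 with h | h
    · rw [hGz z h]; simp
    · exact le_of_eq (by field_simp)
  have hsq : hk π s (s + n + k) x y ^ 2 ≤ (β (s + n + k) * D) ^ 2 := by
    calc _ ≤ _ := hCS
      _ ≤ β (s + n) * D * ∑ z ∈ W, vc π (s + n) z * G z ^ 2 :=
        mul_le_mul_of_nonneg_right hF' hM0
      _ = D * (β (s + n) * ∑ z ∈ W, vc π (s + n) z * G z ^ 2) := by ring
      _ ≤ D * (β (s + n + k) ^ 2 * D) := mul_le_mul_of_nonneg_left hM' hD0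
      _ = _ := by ring
  have hfinal := (le_abs_self _).trans (abs_le_of_sq_le_sq hsq (mul_nonneg hB.le hD0))
  have e : D = (C * lam) ^ (-(d / 2)) * Δ ^ (-(d / 2)) := by
    rw [hD, ← mul_assoc, Real.mul_rpow (by positivity) hΔ0.le]
  rw [e] at hfinal
  exact hfinal.trans_eq (by ring)

end TimeVaryingConductances
end
end

section
/- Let G = (V,E) be a locally finite graph of uniformly bounded degree satisfying a uniform isoperimetric inequality of order d > 2: there is ι > 0 such that for every finite nonempty A ⊆ V, the number of edges of G between A and its complement is at least ι·|A|^{(d−1)/d}. Equip G with time-varying edge conductances that are uniformly elliptic and bounded: π^{(t)}(x,y) ∈ [C₁^{−1}, C₁] for all t ∈ ℕ and all edges or self-loops (x,y) of G, and π^{(t)}(x,y) = 0 otherwise, with C₁ < ∞. Suppose the walk is uniformly lazy with parameter γ ∈ (0,1/2] and that t ↦ π^{(t)}(x) are effectively non-decreasing. Then for all x, y ∈ V, Σ_{t≥0} P(0,x;t,y) < ∞; in particular, for any initial distribution the expected number of visits of the walk to any y ∈ V is finite. -/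
open MeasureTheory

noncomputable section

namespace TimeVaryingConductances

/-- Isoperimetric growth function `ψ_d(t) = ∑_{u<t} κ_u²`. -/
def psi {V : Type} (π : ℕ → V → V → ℝ) (d : ℝ) (t : ℕ) : ℝ :=
  ∑ u ∈ Finset.range t, kappa π d u ^ 2

/-- A locally finite graph with closed neighbourhoods `N x`, each of size at most `D`, satisfying
an isoperimetric inequality of order `d` with constant `ι`. -/
structure IsoGraph {V : Type} (N : V → Finset V) (d ι : ℝ) (D : ℕ) : Prop where
  self_mem : ∀ x, x ∈ N x
  symm : ∀ x y, y ∈ N x → x ∈ N y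
  card_le : ∀ x, (N x).card ≤ D
  iso : ∀ A : Finset V, A.Nonempty →
    ι * (A.card : ℝ) ^ ((d - 1) / d) ≤ ∑ a ∈ A, ∑ b ∈ N a, (A : Set V)ᶜ.indicator 1 b

/-- Co-area inequality: a linear isoperimetric inequality for all nonempty subsets of `A` passes to
nonnegative functions supported in `A`. -/
theorem coarea {V : Type} (N : V → Finset V) {k : ℝ} (A : Finset V) (F : V → ℝ)
    (hF : ∀ x, 0 ≤ F x) (hA : ∀ x ∉ A, F x = 0)
    (hk : ∀ B ⊆ A, B.Nonempty →
      k * (B.card : ℝ) ≤ ∑ a ∈ B, ∑ b ∈ N a, (B : Set V)ᶜ.indicator 1 b) :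
    k * ∑ x ∈ A, F x ≤ ∑ x ∈ A, ∑ y ∈ N x, max (F x - F y) 0 := by
  classical
  induction A using Finset.strongInduction generalizing F with
  | H A ih =>
    rcases A.eq_empty_or_nonempty with rfl | hne
    · simp
    obtain ⟨x₀, hx₀, hmin⟩ := Finset.exists_min_image A F hne
    set m := F x₀ with hm
    set F' : V → ℝ := fun x => if x ∈ A then F x - m else 0 with hF'
    have hF'0 : ∀ x, 0 ≤ F' x := by
      intro x
      by_cases hx : x ∈ A
      · simp [hF', hx, hmin x hx]
      · simp [hF', hx]
    have hF'x₀ : F' x₀ = 0 := by simp [hF', hx₀, hm]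
    have h := ih (A.erase x₀) (Finset.erase_ssubset hx₀) F' hF'0
      (by
        intro x hx
        by_cases hxA : x ∈ A
        · have : x = x₀ := by
            by_contra hne'
            exact hx (Finset.mem_erase.2 ⟨hne', hxA⟩)
          rw [this, hF'x₀]
        · simp [hF', hxA])
      (fun B hB => hk B (hB.trans (Finset.erase_subset _ _)))
    have h1 : ∑ x ∈ A, F x = ∑ x ∈ A.erase x₀, F' x + m * A.card := by
      rw [Finset.sum_erase _ hF'x₀]
      have : ∀ x ∈ A, F x = F' x + m := by
        intro x hx
        simp [hF', hx]
      rw [Finset.sum_congr rfl this, Finset.sum_add_distrib]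
      simp [mul_comm]
    have h2 : ∑ x ∈ A, ∑ y ∈ N x, max (F x - F y) 0
        = ∑ x ∈ A, ∑ y ∈ N x, max (F' x - F' y) 0
          + m * ∑ a ∈ A, ∑ b ∈ N a, (A : Set V)ᶜ.indicator 1 b := by
      rw [Finset.mul_sum, ← Finset.sum_add_distrib]
      refine Finset.sum_congr rfl fun x hx => ?_
      rw [Finset.mul_sum, ← Finset.sum_add_distrib]
      refine Finset.sum_congr rfl fun y _ => ?_
      by_cases hy : y ∈ A
      · simp [hF', hx, hy]
      · have := hmin x hx
        simp [hF', hx, hy, hA y hy]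
        rw [max_eq_left (hF x)]
        rw [max_eq_left (sub_nonneg.2 this)]
        ring
    have h3 : ∑ x ∈ A.erase x₀, ∑ y ∈ N x, max (F' x - F' y) 0
        ≤ ∑ x ∈ A, ∑ y ∈ N x, max (F' x - F' y) 0 :=
      Finset.sum_le_sum_of_subset_of_nonneg (Finset.erase_subset _ _)
        fun _ _ _ => Finset.sum_nonneg fun _ _ => le_max_right _ _
    have h4 := mul_le_mul_of_nonneg_left (hk A subset_rfl hne) (hF x₀)
    rw [h1, h2]
    rw [← hm] at h4
    linarith

/-- Cheeger's inequality for nonnegative functions supported in a finite set. -/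
theorem cheeger_s2 {V : Type} (N : V → Finset V) {D : ℕ} (hD : ∀ x, (N x).card ≤ D)
    {k : ℝ} (hk0 : 0 ≤ k) (A : Finset V) (f : V → ℝ)
    (hf : ∀ x, 0 ≤ f x) (hA : ∀ x ∉ A, f x = 0)
    (hk : ∀ B ⊆ A, B.Nonempty →
      k * (B.card : ℝ) ≤ ∑ a ∈ B, ∑ b ∈ N a, (B : Set V)ᶜ.indicator 1 b) :
    k ^ 2 * ∑ x ∈ A, f x ^ 2 ≤ 4 * D * ∑ x ∈ A, ∑ y ∈ N x, (f x - f y) ^ 2 := by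
  set E := ∑ x ∈ A, f x ^ 2 with hE
  set Q := ∑ x ∈ A, ∑ y ∈ N x, (f x - f y) ^ 2 with hQ
  have hE0 : 0 ≤ E := Finset.sum_nonneg fun _ _ => sq_nonneg _
  have hQ0 : 0 ≤ Q := Finset.sum_nonneg fun _ _ => Finset.sum_nonneg fun _ _ => sq_nonneg _
  have h1 := coarea N A (fun x => f x ^ 2) (fun _ => sq_nonneg _)
    (fun x hx => by simp [hA x hx]) hk
  have h2 : ∑ x ∈ A, ∑ y ∈ N x, max (f x ^ 2 - f y ^ 2) 0
      ≤ ∑ p ∈ A.sigma N, |f p.1 - f p.2| * (2 * f p.1) := by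
    rw [Finset.sum_sigma]
    refine Finset.sum_le_sum fun x _ => Finset.sum_le_sum fun y _ => ?_
    have hx := hf x
    have hy := hf y
    refine max_le ?_ (by positivity)
    rcases le_total (f y) (f x) with h | h
    · rw [abs_of_nonneg (sub_nonneg.2 h)]
      nlinarith
    · have : 0 ≤ |f x - f y| * (2 * f x) := by positivity
      nlinarith
  have h3 := Finset.sum_mul_sq_le_sq_mul_sq (A.sigma N) (fun p => |f p.1 - f p.2|)
    (fun p => 2 * f p.1)
  have h4 : ∑ p ∈ A.sigma N, |f p.1 - f p.2| ^ 2 = Q := by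
    rw [Finset.sum_sigma]
    simp [hQ]
  have h5 : ∑ p ∈ A.sigma N, (2 * f p.1) ^ 2 ≤ 4 * D * E := by
    rw [Finset.sum_sigma, hE, Finset.mul_sum]
    refine Finset.sum_le_sum fun x _ => ?_
    have : ((N x).card : ℝ) ≤ D := by exact_mod_cast hD x
    simp only [Finset.sum_const, nsmul_eq_mul]
    nlinarith [sq_nonneg (f x)]
  have h6 : (k * E) ^ 2 ≤ Q * (4 * D * E) := by
    rw [h4] at h3
    calc (k * E) ^ 2 ≤ (∑ p ∈ A.sigma N, |f p.1 - f p.2| * (2 * f p.1)) ^ 2 :=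
          pow_le_pow_left₀ (by positivity) (h1.trans h2) 2
      _ ≤ _ := h3
      _ ≤ _ := mul_le_mul_of_nonneg_left h5 hQ0
  rcases hE0.eq_or_lt with h | h
  · rw [← h]
    simp only [mul_zero]
    positivity
  · refine le_of_mul_le_mul_right ?_ h
    nlinarith

/-- Nash inequality on a graph satisfying an isoperimetric inequality. -/
theorem IsoGraph.nash {V : Type} {N : V → Finset V} {d ι : ℝ} {D : ℕ}
    (G : IsoGraph N d ι D) (hd : 1 < d) (hι : 0 < ι) (hD : 0 < D) {M : ℝ} (hM : 0 < M) :
    ∃ c > 0, ∀ (S : Finset V) (f : V → ℝ), (∀ x, 0 ≤ f x) → (∀ x ∉ S, f x = 0) →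
      ∑ x ∈ S, f x ≤ M →
      c * (∑ x ∈ S, f x ^ 2) ^ (1 + 2 / d) ≤ ∑ x ∈ S, ∑ y ∈ N x, (f x - f y) ^ 2 := by
  classical
  have hD' : (0 : ℝ) < D := by exact_mod_cast hD
  have hd0 : 0 < d := by linarith
  refine ⟨ι ^ 2 * (4 * M ^ 2) ^ (-(2 / d)) / (8 * D), by positivity, ?_⟩
  intro S f hf hS hfM
  set E := ∑ x ∈ S, f x ^ 2 with hE
  have hE0 : 0 ≤ E := Finset.sum_nonneg fun _ _ => sq_nonneg _
  rcases hE0.eq_or_lt with h0 | hEpos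
  · rw [← h0, Real.zero_rpow (by positivity), mul_zero]
    exact Finset.sum_nonneg fun _ _ => Finset.sum_nonneg fun _ _ => sq_nonneg _
  set s := E / (4 * M) with hs
  have hs0 : 0 < s := by positivity
  set g : V → ℝ := fun x => max (f x - s) 0 with hg
  set A := S.filter (fun x => s < f x) with hAdef
  have hg0 : ∀ x, 0 ≤ g x := fun x => le_max_right _ _
  have hgA : ∀ x ∉ A, g x = 0 := by
    intro x hx
    refine max_eq_right ?_
    by_contra! h
    have hsx : s < f x := by linarith
    exact hx (Finset.mem_filter.2 ⟨by
      by_contra hxS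
      rw [hS x hxS] at hsx
      linarith, hsx⟩)
  have hAS : A ⊆ S := Finset.filter_subset _ _
  have hcard : (A.card : ℝ) * s ≤ M := by
    calc (A.card : ℝ) * s = ∑ x ∈ A, s := by simp
      _ ≤ ∑ x ∈ A, f x := Finset.sum_le_sum fun x hx => (Finset.mem_filter.1 hx).2.le
      _ ≤ ∑ x ∈ S, f x := Finset.sum_le_sum_of_subset_of_nonneg hAS fun x _ _ => hf x
      _ ≤ M := hfM
  have hEg : E / 2 ≤ ∑ x ∈ A, g x ^ 2 := by
    have h1 : ∑ x ∈ A, g x ^ 2 = ∑ x ∈ S, g x ^ 2 :=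
      Finset.sum_subset hAS fun x _ hx => by simp [hgA x hx]
    have h2 : E ≤ ∑ x ∈ S, (g x ^ 2 + 2 * s * f x) := by
      refine Finset.sum_le_sum fun x _ => ?_
      have := hf x
      rcases le_total (f x) s with h | h
      · have : g x = 0 := max_eq_right (by linarith)
        rw [this]
        nlinarith
      · have : g x = f x - s := max_eq_left (by linarith)
        rw [this]
        nlinarith
    rw [Finset.sum_add_distrib, ← Finset.mul_sum, ← h1] at h2
    have h3 : 2 * s * ∑ x ∈ S, f x ≤ 2 * s * M := by gcongr
    have h4 : 2 * s * M = E / 2 := by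
      rw [hs]
      field_simp
      ring
    linarith
  have hAne : A.Nonempty := by
    by_contra h
    rw [Finset.not_nonempty_iff_eq_empty] at h
    rw [h] at hEg
    simp at hEg
    linarith
  have hApos : (0 : ℝ) < A.card := by exact_mod_cast hAne.card_pos
  set k := ι * (A.card : ℝ) ^ (-(1 / d)) with hk
  have hch := cheeger_s2 N G.card_le (k := k) (by positivity) A g hg0 hgA (by
    intro B hB hBne
    have hBpos : (0 : ℝ) < B.card := by exact_mod_cast hBne.card_pos
    refine le_trans ?_ (G.iso B hBne)
    have h1 : (B.card : ℝ) ^ ((d - 1) / d) = (B.card : ℝ) ^ (-(1 / d)) * B.card := by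
      rw [← Real.rpow_add_one hBpos.ne']
      congr 1
      field_simp
      ring
    rw [h1, hk, mul_assoc]
    gcongr ?_ * (?_ * ?_)
    exact Real.rpow_le_rpow_of_nonpos hBpos (by exact_mod_cast Finset.card_le_card hB)
      (by simp only [Left.neg_nonpos_iff]; positivity))
  have hk2 : ι ^ 2 * (4 * M ^ 2) ^ (-(2 / d)) * E ^ (2 / d) ≤ k ^ 2 := by
    have h1 : k ^ 2 = ι ^ 2 * (A.card : ℝ) ^ (-(2 / d)) := by
      rw [hk, mul_pow, ← Real.rpow_natCast ((A.card : ℝ) ^ (-(1 / d))), ← Real.rpow_mul hApos.le]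
      congr 2
      push_cast
      ring
    have h2 : (A.card : ℝ) ≤ 4 * M ^ 2 / E := by
      rw [le_div_iff₀ hEpos]
      rw [hs] at hcard
      have : (A.card : ℝ) * (E / (4 * M)) * (4 * M) = A.card * E := by field_simp
      nlinarith
    rw [h1, mul_assoc]
    gcongr
    calc (4 * M ^ 2) ^ (-(2 / d)) * E ^ (2 / d) = (4 * M ^ 2 / E) ^ (-(2 / d)) := by
          rw [Real.div_rpow (by positivity) hE0, Real.rpow_neg hE0, div_inv_eq_mul]
      _ ≤ _ := Real.rpow_le_rpow_of_nonpos hApos h2 (by simp only [Left.neg_nonpos_iff]; positivity)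
  have hDir : ∑ x ∈ A, ∑ y ∈ N x, (g x - g y) ^ 2 ≤ ∑ x ∈ S, ∑ y ∈ N x, (f x - f y) ^ 2 := by
    refine (Finset.sum_le_sum_of_subset_of_nonneg hAS
      fun _ _ _ => Finset.sum_nonneg fun _ _ => sq_nonneg _).trans ?_
    refine Finset.sum_le_sum fun x _ => Finset.sum_le_sum fun y _ => ?_
    refine sq_le_sq.2 ?_
    have := abs_max_sub_max_le_abs (f x - s) (f y - s) 0
    simpa [hg] using this
  have h5 : ι ^ 2 * (4 * M ^ 2) ^ (-(2 / d)) * E ^ (2 / d) * (E / 2) ≤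
      4 * D * ∑ x ∈ S, ∑ y ∈ N x, (f x - f y) ^ 2 := by
    calc _ ≤ k ^ 2 * ∑ x ∈ A, g x ^ 2 := by gcongr
      _ ≤ _ := hch
      _ ≤ _ := by gcongr
  have h6 : E ^ (1 + 2 / d) = E ^ (2 / d) * E := by
    rw [add_comm, Real.rpow_add_one hEpos.ne']
  rw [h6, div_mul_eq_mul_div, div_le_iff₀ (by positivity)]
  linarith

/-- Polynomial decay for a sequence with `a (n + 1) ≤ a n - c * a n ^ (1 + δ)`. -/
theorem decay_of_recursion {a : ℕ → ℝ} {c δ : ℝ} (hc : 0 < c) (hδ : 0 < δ) (T : ℕ)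
    (ha : ∀ n ≤ T, 0 ≤ a n) (hrec : ∀ n < T, a (n + 1) ≤ a n - c * a n ^ (1 + δ)) :
    ∀ n ≤ T, n * (δ * c) * a n ^ δ ≤ 1 := by
  intro n
  induction n with
  | zero => intro; simp
  | succ n ih =>
    intro hn
    have ih := ih (by omega)
    have h0 := ha n (by omega)
    have h1 := ha (n + 1) hn
    have hr := hrec n (by omega)
    rcases h1.eq_or_lt with h | h
    · rw [← h, Real.zero_rpow hδ.ne']
      simp
    rcases h0.eq_or_lt with h' | hpos
    · rw [← h', Real.zero_rpow (by positivity)] at hr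
      linarith
    set b := a n ^ δ with hb
    have hb0 : 0 < b := by positivity
    have h2 : a (n + 1) ≤ a n * Real.exp (-(c * b)) := by
      have h3 : a n ^ (1 + δ) = a n * b := by
        rw [add_comm, Real.rpow_add_one hpos.ne', mul_comm]
      have h4 := Real.add_one_le_exp (-(c * b))
      rw [h3] at hr
      nlinarith
    have h5 : a (n + 1) ^ δ ≤ b * Real.exp (-(δ * c * b)) := by
      calc a (n + 1) ^ δ ≤ (a n * Real.exp (-(c * b))) ^ δ := by gcongr
        _ = b * Real.exp (-(δ * c * b)) := by
          rw [Real.mul_rpow h0 (Real.exp_pos _).le, ← Real.exp_mul]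
          congr 2
          ring
    have h6 := Real.add_one_le_exp (δ * c * b)
    have h7 : a (n + 1) ^ δ * (1 + δ * c * b) ≤ b := by
      calc a (n + 1) ^ δ * (1 + δ * c * b)
          ≤ b * Real.exp (-(δ * c * b)) * Real.exp (δ * c * b) := by
            gcongr
            linarith
        _ = b := by rw [mul_assoc, ← Real.exp_add]; simp
    have h8 : 0 < δ * c * b := by positivity
    have h9 : (n + 1) * (δ * c) * (a (n + 1) ^ δ) * (1 + δ * c * b) ≤ 1 * (1 + δ * c * b) := by
      calc (n + 1) * (δ * c) * (a (n + 1) ^ δ) * (1 + δ * c * b)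
          = (n + 1) * (δ * c) * (a (n + 1) ^ δ * (1 + δ * c * b)) := by ring
        _ ≤ (n + 1) * (δ * c) * b := by gcongr
        _ ≤ _ := by linarith
    push_cast
    exact le_of_mul_le_mul_right h9 (by positivity)

/-- Polynomial decay rate for a sequence with `a (n + 1) ≤ a n - c * a n ^ (1 + δ)`. -/
theorem le_rpow_of_recursion {a : ℕ → ℝ} {c δ : ℝ} (hc : 0 < c) (hδ : 0 < δ) (T : ℕ)
    (ha : ∀ n ≤ T, 0 ≤ a n) (hrec : ∀ n < T, a (n + 1) ≤ a n - c * a n ^ (1 + δ))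
    {n : ℕ} (hn : n ≤ T) (hn0 : 0 < n) : a n ≤ (n * (δ * c)) ^ (-(1 / δ)) := by
  have h := decay_of_recursion hc hδ T ha hrec n hn
  have hn' : (0 : ℝ) < n := by exact_mod_cast hn0
  have hp : 0 < n * (δ * c) := by positivity
  have h1 : a n ^ δ ≤ (n * (δ * c))⁻¹ := by
    rw [← one_div, le_div_iff₀ hp]
    linarith
  calc a n = (a n ^ δ) ^ (1 / δ) := by
        rw [← Real.rpow_mul (ha n hn), mul_one_div_cancel hδ.ne', Real.rpow_one]
    _ ≤ ((n * (δ * c))⁻¹) ^ (1 / δ) :=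
        Real.rpow_le_rpow (Real.rpow_nonneg (ha n hn) _) h1 (by positivity)
    _ = _ := by rw [Real.inv_rpow hp.le, Real.rpow_neg hp.le]

/-- Conductances `q` with vertex conductances `w`, uniformly elliptic on the edges described by `N`
and lazy with parameter `γ`. -/
structure Conductance {V : Type} (N : V → Finset V) (C γ : ℝ) (q : V → V → ℝ) (w : V → ℝ) :
    Prop where
  symm : ∀ x y, q x y = q y x
  lower : ∀ x, ∀ y ∈ N x, C⁻¹ ≤ q x y
  upper : ∀ x, ∀ y ∈ N x, q x y ≤ C
  zero : ∀ x, ∀ y ∉ N x, q x y = 0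
  mass : ∀ x, w x = ∑ y ∈ N x, q x y
  lazy : ∀ x, γ * w x ≤ q x x

/-- The Markov operator `f ↦ (x ↦ ∑ y, q x y / w x * f y)`. -/
def avg {V : Type} (N : V → Finset V) (q : V → V → ℝ) (w : V → ℝ) (f : V → ℝ) (x : V) : ℝ :=
  ∑ y ∈ N x, q x y / w x * f y

namespace Conductance

variable {V : Type} {N : V → Finset V} {C γ d ι : ℝ} {D : ℕ} {q : V → V → ℝ} {w f : V → ℝ}

theorem nonneg (H : Conductance N C γ q w) (hC : 0 < C) (x y : V) : 0 ≤ q x y := by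
  by_cases h : y ∈ N x
  · exact (inv_pos.2 hC).le.trans (H.lower x y h)
  · exact (H.zero x y h).ge

theorem le_mass (H : Conductance N C γ q w) (G : IsoGraph N d ι D) (hC : 0 < C) (x : V) :
    C⁻¹ ≤ w x := by
  rw [H.mass]
  exact (H.lower x x (G.self_mem x)).trans
    (Finset.single_le_sum (f := fun y => q x y) (fun y _ => H.nonneg hC x y) (G.self_mem x))

theorem mass_pos (H : Conductance N C γ q w) (G : IsoGraph N d ι D) (hC : 0 < C) (x : V) :
    0 < w x :=
  (inv_pos.2 hC).trans_le (H.le_mass G hC x)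

theorem mass_le (H : Conductance N C γ q w) (G : IsoGraph N d ι D) (hC : 0 < C) (x : V) :
    w x ≤ C * D := by
  rw [H.mass]
  have hD : ((N x).card : ℝ) ≤ D := by exact_mod_cast G.card_le x
  calc ∑ y ∈ N x, q x y ≤ ∑ y ∈ N x, C := Finset.sum_le_sum fun y hy => H.upper x y hy
    _ = C * (N x).card := by simp [mul_comm]
    _ ≤ C * D := by gcongr

theorem mass_mul_avg (H : Conductance N C γ q w) (G : IsoGraph N d ι D) (hC : 0 < C) (f : V → ℝ)
    (x : V) : w x * avg N q w f x = ∑ y ∈ N x, q x y * f y := by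
  have := (H.mass_pos G hC x).ne'
  rw [avg, Finset.mul_sum]
  refine Finset.sum_congr rfl fun y _ => ?_
  field_simp

theorem avg_nonneg (H : Conductance N C γ q w) (G : IsoGraph N d ι D) (hC : 0 < C)
    (hf : ∀ x, 0 ≤ f x) (x : V) : 0 ≤ avg N q w f x :=
  Finset.sum_nonneg fun y _ =>
    mul_nonneg (div_nonneg (H.nonneg hC x y) (H.mass_pos G hC x).le) (hf y)

/-- The variance of `f` under one lazy step controls the local gradient of `f`. -/
theorem mass_mul_avg_sq_add_le (H : Conductance N C γ q w) (G : IsoGraph N d ι D) (hC : 0 < C)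
    (f : V → ℝ) (x : V) :
    w x * avg N q w f x ^ 2 + γ * ∑ y ∈ N x, q x y * (f x - f y) ^ 2
      ≤ ∑ y ∈ N x, q x y * f y ^ 2 := by
  classical
  have hw := H.mass_pos G hC x
  set R := ∑ y ∈ N x, q x y * (f x - f y) ^ 2 with hR
  set L := ∑ y ∈ N x, q x y * (f y - f x) with hL
  have hR' : R = ∑ y ∈ (N x).erase x, q x y * (f x - f y) ^ 2 := by
    rw [Finset.sum_erase]
    simp
  have hL' : L = ∑ y ∈ (N x).erase x, q x y * (f y - f x) := by
    rw [Finset.sum_erase]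
    simp
  have hR0 : 0 ≤ R := Finset.sum_nonneg fun y _ => mul_nonneg (H.nonneg hC x y) (sq_nonneg _)
  have herase : ∑ y ∈ (N x).erase x, q x y ≤ (1 - γ) * w x := by
    have h1 := Finset.add_sum_erase (N x) (fun y => q x y) (G.self_mem x)
    have h2 := H.lazy x
    rw [← H.mass] at h1
    linarith
  have hCS : L ^ 2 ≤ (1 - γ) * w x * R := by
    have h := Finset.sum_sq_le_sum_mul_sum_of_sq_le_mul ((N x).erase x)
      (r := fun y => q x y * (f y - f x)) (f := fun y => q x y)
      (g := fun y => q x y * (f x - f y) ^ 2)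
      (fun y _ => H.nonneg hC x y) (fun y _ => mul_nonneg (H.nonneg hC x y) (sq_nonneg _))
      (fun y _ => le_of_eq (by ring))
    rw [← hL', ← hR'] at h
    exact h.trans (mul_le_mul_of_nonneg_right herase hR0)
  have hLavg : L = w x * (avg N q w f x - f x) := by
    rw [mul_sub, H.mass_mul_avg G hC, hL, H.mass x, Finset.sum_mul, ← Finset.sum_sub_distrib]
    exact Finset.sum_congr rfl fun y _ => by ring
  have hexp : ∑ y ∈ N x, q x y * f y ^ 2 = R + 2 * f x * L + f x ^ 2 * w x := by
    rw [H.mass x, hR, hL, Finset.mul_sum, Finset.mul_sum, ← Finset.sum_add_distrib,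
      ← Finset.sum_add_distrib]
    exact Finset.sum_congr rfl fun y _ => by ring
  have hkey : w x * (avg N q w f x - f x) ^ 2 ≤ (1 - γ) * R := by
    refine le_of_mul_le_mul_left ?_ hw
    rw [hLavg] at hCS
    nlinarith
  rw [hexp, hLavg]
  nlinarith

theorem avg_eq_zero [DecidableEq V] (G : IsoGraph N d ι D) {S : Finset V}
    (hS : ∀ x ∉ S, f x = 0) : ∀ x ∉ S.biUnion N, avg N q w f x = 0 := by
  intro x hx
  refine Finset.sum_eq_zero fun y hy => ?_
  rw [hS y, mul_zero]
  exact fun hyS => hx (Finset.mem_biUnion.2 ⟨y, hyS, G.symm x y hy⟩)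

theorem support_avg_finite (G : IsoGraph N d ι D) (hf : f.support.Finite) :
    (avg N q w f).support.Finite := by
  classical
  have hS : ∀ x ∉ hf.toFinset, f x = 0 := fun x hx => by simpa using hx
  refine (hf.toFinset.biUnion N).finite_toSet.subset fun x hx => ?_
  by_contra h
  exact hx (avg_eq_zero G hS x h)

/-- Reversibility: total mass of one step. -/
theorem sum_sum_eq [DecidableEq V] (H : Conductance N C γ q w) {S : Finset V}
    (hS : ∀ x ∉ S, f x = 0) :
    ∑ x ∈ S.biUnion N, ∑ y ∈ N x, q x y * f y = ∑ y ∈ S, w y * f y := by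
  have h1 : ∀ x, ∑ y ∈ N x, q x y * f y = ∑ y ∈ S, q x y * f y := by
    intro x
    have hl : ∑ y ∈ N x, q x y * f y = ∑ y ∈ N x ∪ S, q x y * f y :=
      Finset.sum_subset Finset.subset_union_left fun y _ hy => by rw [H.zero x y hy, zero_mul]
    have hr : ∑ y ∈ S, q x y * f y = ∑ y ∈ N x ∪ S, q x y * f y :=
      Finset.sum_subset Finset.subset_union_right fun y _ hy => by rw [hS y hy, mul_zero]
    rw [hl, hr]
  simp_rw [h1]
  rw [Finset.sum_comm]
  refine Finset.sum_congr rfl fun y hy => ?_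
  rw [← Finset.sum_mul, H.mass y]
  congr 1
  simp_rw [H.symm _ y]
  refine (Finset.sum_subset (fun x hx => Finset.mem_biUnion.2 ⟨y, hy, hx⟩) fun x _ hx => ?_).symm
  exact H.zero y x hx

theorem tsum_mass_mul_avg (H : Conductance N C γ q w) (G : IsoGraph N d ι D) (hC : 0 < C)
    (hf : f.support.Finite) : ∑' x, w x * avg N q w f x = ∑' x, w x * f x := by
  classical
  have hS : ∀ x ∉ hf.toFinset, f x = 0 := fun x hx => by simpa using hx
  rw [tsum_eq_sum (s := hf.toFinset.biUnion N)
      (fun x hx => by rw [avg_eq_zero G hS x hx, mul_zero]),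
    tsum_eq_sum (s := hf.toFinset) (fun x hx => by rw [hS x hx, mul_zero]),
    ← H.sum_sum_eq hS]
  exact Finset.sum_congr rfl fun x _ => H.mass_mul_avg G hC f x

end Conductance

/-- One lazy step decreases the energy by at least a power of the energy, uniformly over all
elliptic conductances. -/
theorem IsoGraph.energy_avg_add_le {V : Type} {N : V → Finset V} {d ι : ℝ} {D : ℕ}
    (G : IsoGraph N d ι D) (hd : 1 < d) (hι : 0 < ι) (hD : 0 < D) {M C γ : ℝ} (hM : 0 < M)
    (hC : 0 < C) (hγ : 0 < γ) :
    ∃ c > 0, ∀ (q : V → V → ℝ) (w f : V → ℝ), Conductance N C γ q w → (∀ x, 0 ≤ f x) →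
      f.support.Finite → ∑' x, w x * f x ≤ M →
      ∑' x, w x * avg N q w f x ^ 2 + c * (∑' x, w x * f x ^ 2) ^ (1 + 2 / d)
        ≤ ∑' x, w x * f x ^ 2 := by
  classical
  obtain ⟨c, hc, hnash⟩ := G.nash hd hι hD (M := C * M) (by positivity)
  have hD' : (0 : ℝ) < D := by exact_mod_cast hD
  refine ⟨γ * C⁻¹ * c * (C * D)⁻¹ ^ (1 + 2 / d), by positivity, ?_⟩
  intro q w f H hf hfin hmass
  have hS : ∀ x ∉ hfin.toFinset, f x = 0 := fun x hx => by simpa using hx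
  set S := hfin.toFinset
  set S' := S.biUnion N with hS'def
  have hSS' : S ⊆ S' := fun x hx => Finset.mem_biUnion.2 ⟨x, hx, G.self_mem x⟩
  have hS' : ∀ x ∉ S', f x = 0 := fun x hx => hS x fun h => hx (hSS' h)
  rw [tsum_eq_sum (s := S') (fun x hx => by rw [hS' x hx, mul_zero])] at hmass
  rw [tsum_eq_sum (s := S')
      (fun x hx => by rw [Conductance.avg_eq_zero G hS x hx]; ring),
    tsum_eq_sum (s := S') (fun x hx => by rw [hS' x hx]; ring)]
  have hE : ∑ x ∈ S', ∑ y ∈ N x, q x y * f y ^ 2 = ∑ x ∈ S', w x * f x ^ 2 := by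
    rw [H.sum_sum_eq (f := fun y => f y ^ 2) (S := S) (fun x hx => by simp [hS x hx])]
    exact Finset.sum_subset hSS' fun x _ hx => by simp [hS x hx]
  have hvar := Finset.sum_le_sum fun x (_ : x ∈ S') => H.mass_mul_avg_sq_add_le G hC f x
  rw [Finset.sum_add_distrib, hE, ← Finset.mul_sum] at hvar
  have hgrad : C⁻¹ * ∑ x ∈ S', ∑ y ∈ N x, (f x - f y) ^ 2
      ≤ ∑ x ∈ S', ∑ y ∈ N x, q x y * (f x - f y) ^ 2 := by
    rw [Finset.mul_sum]
    refine Finset.sum_le_sum fun x _ => ?_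
    rw [Finset.mul_sum]
    refine Finset.sum_le_sum fun y hy => ?_
    gcongr
    exact H.lower x y hy
  have hsum : ∑ x ∈ S', f x ≤ C * M := by
    rw [← inv_mul_le_iff₀ hC, Finset.mul_sum]
    refine le_trans (Finset.sum_le_sum fun x _ => ?_) hmass
    exact mul_le_mul_of_nonneg_right (H.le_mass G hC x) (hf x)
  have hn := hnash S' f hf hS' hsum
  have hcomp : (C * D)⁻¹ * ∑ x ∈ S', w x * f x ^ 2 ≤ ∑ x ∈ S', f x ^ 2 := by
    rw [inv_mul_le_iff₀ (by positivity), Finset.mul_sum]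
    refine Finset.sum_le_sum fun x _ => ?_
    gcongr
    exact H.mass_le G hC x
  have hE0 : 0 ≤ ∑ x ∈ S', w x * f x ^ 2 :=
    Finset.sum_nonneg fun x _ => mul_nonneg (H.mass_pos G hC x).le (sq_nonneg _)
  have hpow : (C * D)⁻¹ ^ (1 + 2 / d) * (∑ x ∈ S', w x * f x ^ 2) ^ (1 + 2 / d)
      ≤ (∑ x ∈ S', f x ^ 2) ^ (1 + 2 / d) := by
    rw [← Real.mul_rpow (by positivity) hE0]
    exact Real.rpow_le_rpow (by positivity) hcomp (by positivity)
  have hfinal : γ * C⁻¹ * c * (C * D)⁻¹ ^ (1 + 2 / d) *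
      (∑ x ∈ S', w x * f x ^ 2) ^ (1 + 2 / d)
      ≤ γ * ∑ x ∈ S', ∑ y ∈ N x, q x y * (f x - f y) ^ 2 := by
    calc _ = γ * (C⁻¹ * (c * ((C * D)⁻¹ ^ (1 + 2 / d) *
          (∑ x ∈ S', w x * f x ^ 2) ^ (1 + 2 / d)))) := by ring
      _ ≤ γ * (C⁻¹ * (c * (∑ x ∈ S', f x ^ 2) ^ (1 + 2 / d))) := by gcongr
      _ ≤ γ * (C⁻¹ * ∑ x ∈ S', ∑ y ∈ N x, (f x - f y) ^ 2) := by gcongr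
      _ ≤ _ := by gcongr
  linarith

section HeatKernel

variable {V : Type} {N : V → Finset V} {C γ d ι : ℝ} {D : ℕ} {π : ℕ → V → V → ℝ}

theorem Pn_zero_self (π : ℕ → V → V → ℝ) (s : ℕ) (x : V) : Pn π s 0 x x = 1 := by
  simp [Pn]

theorem Pn_zero_of_ne (π : ℕ → V → V → ℝ) (s : ℕ) {x y : V} (h : x ≠ y) : Pn π s 0 x y = 0 := by
  simp [Pn, h]

theorem step_eq_zero (H : ∀ t, Conductance N C γ (π t) (vc π t)) (t : ℕ) {y z : V}
    (h : z ∉ N y) : step π t z y = 0 := by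
  rw [step, (H t).symm, (H t).zero y z h, zero_div]

theorem Pn_succ (H : ∀ t, Conductance N C γ (π t) (vc π t)) (s n : ℕ) (x y : V) :
    Pn π s (n + 1) x y = ∑ z ∈ N y, Pn π s n x z * step π (s + n) z y := by
  rw [Pn]
  exact tsum_eq_sum fun z hz => by rw [step_eq_zero H _ hz, mul_zero]

theorem support_Pn_finite (G : IsoGraph N d ι D) (H : ∀ t, Conductance N C γ (π t) (vc π t))
    (s n : ℕ) (x : V) : (Pn π s n x).support.Finite := by
  classical
  induction n with
  | zero =>
    refine (Set.finite_singleton x).subset fun y hy => ?_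
    by_contra h
    exact hy (Pn_zero_of_ne π s fun h' => h h'.symm)
  | succ n ih =>
    refine (ih.toFinset.biUnion N).finite_toSet.subset fun y hy => ?_
    by_contra h
    refine hy ?_
    rw [Pn_succ H]
    refine Finset.sum_eq_zero fun z hz => ?_
    have : Pn π s n x z = 0 := by
      by_contra hne
      exact h (Finset.mem_coe.2 (Finset.mem_biUnion.2
        ⟨z, ih.mem_toFinset.2 hne, G.symm y z hz⟩))
    rw [this, zero_mul]

/-- Chapman–Kolmogorov equation. -/
theorem Pn_add (G : IsoGraph N d ι D) (H : ∀ t, Conductance N C γ (π t) (vc π t))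
    (s m n : ℕ) (x y : V) :
    Pn π s (m + n) x y = ∑' z, Pn π s m x z * Pn π (s + m) n z y := by
  have hfin := support_Pn_finite G H s m x
  have hS : ∀ z ∉ hfin.toFinset, Pn π s m x z = 0 := fun z hz => by simpa using hz
  induction n generalizing y with
  | zero =>
    rw [tsum_eq_single y fun z hz => by rw [Pn_zero_of_ne π _ hz, mul_zero], Pn_zero_self, mul_one,
      add_zero]
  | succ n ih =>
    rw [← add_assoc, Pn_succ H]
    simp_rw [ih]
    rw [tsum_eq_sum (s := hfin.toFinset) (fun z hz => by rw [hS z hz, zero_mul])]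
    have h1 : ∀ u, ∑' z, Pn π s m x z * Pn π (s + m) n z u
        = ∑ z ∈ hfin.toFinset, Pn π s m x z * Pn π (s + m) n z u :=
      fun u => tsum_eq_sum fun z hz => by rw [hS z hz, zero_mul]
    simp_rw [h1, Pn_succ H, Finset.sum_mul, Finset.mul_sum]
    rw [Finset.sum_comm]
    refine Finset.sum_congr rfl fun z _ => Finset.sum_congr rfl fun u _ => ?_
    rw [add_assoc, mul_assoc]

theorem Pn_one (π : ℕ → V → V → ℝ) (s : ℕ) (x z : V) : Pn π s 1 x z = step π s x z := by
  change ∑' u, Pn π s 0 x u * step π (s + 0) u z = _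
  rw [tsum_eq_single x fun u hu => by rw [Pn_zero_of_ne π _ hu.symm, zero_mul], Pn_zero_self,
    one_mul, add_zero]

/-- Backward equation: first-step decomposition. -/
theorem Pn_succ_eq_avg (G : IsoGraph N d ι D) (H : ∀ t, Conductance N C γ (π t) (vc π t))
    (s n : ℕ) (x y : V) :
    Pn π s (n + 1) x y = avg N (π s) (vc π s) (fun z => Pn π (s + 1) n z y) x := by
  rw [add_comm, Pn_add G H, avg]
  simp_rw [Pn_one]
  exact tsum_eq_sum fun z hz => by rw [step, (H s).zero x z hz, zero_div, zero_mul]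

theorem support_Pn_left_finite (G : IsoGraph N d ι D)
    (H : ∀ t, Conductance N C γ (π t) (vc π t)) (s n : ℕ) (y : V) :
    (fun x => Pn π s n x y).support.Finite := by
  induction n generalizing s with
  | zero =>
    refine (Set.finite_singleton y).subset fun x hx => ?_
    by_contra h
    exact hx (Pn_zero_of_ne π s h)
  | succ n ih =>
    simp_rw [Pn_succ_eq_avg G H]
    exact Conductance.support_avg_finite G (ih _)

theorem Pn_nonneg_s2 (G : IsoGraph N d ι D) (hC : 0 < C)
    (H : ∀ t, Conductance N C γ (π t) (vc π t)) (s n : ℕ) (x y : V) : 0 ≤ Pn π s n x y := by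
  induction n generalizing s x with
  | zero => simp only [Pn]; split_ifs <;> norm_num
  | succ n ih =>
    rw [Pn_succ_eq_avg G H]
    exact (H s).avg_nonneg G hC (fun z => ih _ z) x

theorem Pn_le_one (G : IsoGraph N d ι D) (hC : 0 < C)
    (H : ∀ t, Conductance N C γ (π t) (vc π t)) (s n : ℕ) (x y : V) : Pn π s n x y ≤ 1 := by
  induction n generalizing s x with
  | zero => simp only [Pn]; split_ifs <;> norm_num
  | succ n ih =>
    have hw := (H s).mass_pos G hC x
    rw [Pn_succ_eq_avg G H, ← mul_le_mul_iff_right₀ hw, (H s).mass_mul_avg G hC, mul_one,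
      (H s).mass x]
    exact Finset.sum_le_sum fun z _ =>
      mul_le_of_le_one_right ((H s).nonneg hC x z) (ih _ z)

/-- Forward equation for the heat kernel. -/
theorem Pn_succ_eq_mass_mul_avg (G : IsoGraph N d ι D) (hC : 0 < C)
    (H : ∀ t, Conductance N C γ (π t) (vc π t)) (n : ℕ) (x y : V) :
    Pn π 0 (n + 1) x y = vc π n y * avg N (π n) (vc π n) (fun z => hk π 0 n x z) y := by
  rw [(H n).mass_mul_avg G hC, Pn_succ H]
  refine Finset.sum_congr rfl fun z _ => ?_
  rw [zero_add, step, hk, (H n).symm z y, Nat.sub_zero]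
  ring

theorem mass_mul_hk (G : IsoGraph N d ι D) (hC : 0 < C)
    (H : ∀ t, Conductance N C γ (π t) (vc π t)) (n : ℕ) (x y : V) :
    vc π n y * hk π 0 n x y = Pn π 0 n x y := by
  rw [hk, Nat.sub_zero, mul_div_cancel₀ _ ((H n).mass_pos G hC y).ne']

theorem support_hk_finite (G : IsoGraph N d ι D)
    (H : ∀ t, Conductance N C γ (π t) (vc π t)) (n : ℕ) (x : V) :
    (fun y => hk π 0 n x y).support.Finite := by
  refine (support_Pn_finite G H 0 n x).subset fun y hy h => hy ?_
  have h' : Pn π 0 n x y = 0 := h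
  simp [hk, h']

theorem hk_nonneg (G : IsoGraph N d ι D) (hC : 0 < C)
    (H : ∀ t, Conductance N C γ (π t) (vc π t)) (n : ℕ) (x y : V) : 0 ≤ hk π 0 n x y :=
  div_nonneg (Pn_nonneg_s2 G hC H _ _ x y) ((H n).mass_pos G hC y).le

theorem tsum_Pn (G : IsoGraph N d ι D) (hC : 0 < C)
    (H : ∀ t, Conductance N C γ (π t) (vc π t)) (n : ℕ) (x : V) : ∑' y, Pn π 0 n x y = 1 := by
  induction n with
  | zero => rw [tsum_eq_single x fun y hy => Pn_zero_of_ne π _ hy.symm, Pn_zero_self]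
  | succ n ih =>
    simp_rw [Pn_succ_eq_mass_mul_avg G hC H]
    rw [(H n).tsum_mass_mul_avg G hC (support_hk_finite G H n x)]
    simp_rw [mass_mul_hk G hC H]
    exact ih

theorem summable_mul_of_support_finite {f : V → ℝ} (hf : f.support.Finite) (w : V → ℝ) (g : ℝ → ℝ)
    (hg : g 0 = 0) : Summable fun x => w x * g (f x) := by
  refine summable_of_hasFiniteSupport (hf.subset fun x hx h => hx ?_)
  have h' : f x = 0 := h
  simp [h', hg]

/-- Energy decay of the forward heat kernel. -/
theorem tsum_mass_mul_hk_sq_le (G : IsoGraph N d ι D) (hd : 1 < d) (hι : 0 < ι) (hD : 0 < D)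
    (hC : 0 < C) (hγ : 0 < γ) :
    ∃ c > 0, ∀ π : ℕ → V → V → ℝ, (∀ t, Conductance N C γ (π t) (vc π t)) →
      (∀ t x, vc π t x ≤ vc π (t + 1) x) → ∀ (n : ℕ) (x : V), 0 < n →
      ∑' y, vc π n y * hk π 0 n x y ^ 2 ≤ (n * c) ^ (-(d / 2)) := by
  obtain ⟨c, hc, hE⟩ := G.energy_avg_add_le hd hι hD (M := 1) one_pos hC hγ
  refine ⟨2 / d * c, by positivity, ?_⟩
  intro π H hmono n x hn
  have hpos := fun n y => (H n).mass_pos G hC y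
  have key : ∀ n, ∑' y, vc π (n + 1) y * hk π 0 (n + 1) x y ^ 2
      ≤ ∑' y, vc π n y * hk π 0 n x y ^ 2
        - c * (∑' y, vc π n y * hk π 0 n x y ^ 2) ^ (1 + 2 / d) := by
    intro n
    have h1 := hE (π n) (vc π n) (fun y => hk π 0 n x y) (H n) (hk_nonneg G hC H n x)
      (support_hk_finite G H n x) (by simp_rw [mass_mul_hk G hC H, tsum_Pn G hC H]; rfl)
    have h2 : ∑' y, vc π (n + 1) y * hk π 0 (n + 1) x y ^ 2
        ≤ ∑' y, vc π n y * avg N (π n) (vc π n) (fun z => hk π 0 n x z) y ^ 2 := by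
      refine Summable.tsum_le_tsum (fun y => ?_)
        (summable_mul_of_support_finite (support_hk_finite G H (n + 1) x) _ (· ^ 2) (by simp))
        (summable_mul_of_support_finite
          (Conductance.support_avg_finite G (support_hk_finite G H n x)) _ (· ^ 2) (by simp))
      have h3 := mass_mul_hk G hC H (n + 1) x y
      rw [Pn_succ_eq_mass_mul_avg G hC H] at h3
      refine le_of_mul_le_mul_left ?_ (hpos (n + 1) y)
      calc vc π (n + 1) y * (vc π (n + 1) y * hk π 0 (n + 1) x y ^ 2)
          = vc π n y * (vc π n y * avg N (π n) (vc π n) (fun z => hk π 0 n x z) y ^ 2) := by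
            linear_combination (vc π (n + 1) y * hk π 0 (n + 1) x y
              + vc π n y * avg N (π n) (vc π n) (fun z => hk π 0 n x z) y) * h3
        _ ≤ _ := mul_le_mul_of_nonneg_right (hmono n y)
            (mul_nonneg (hpos n y).le (sq_nonneg _))
    linarith
  have := le_rpow_of_recursion (a := fun n => ∑' y, vc π n y * hk π 0 n x y ^ 2) hc
    (δ := 2 / d) (by positivity) n
    (fun n _ => tsum_nonneg fun y => mul_nonneg (hpos n y).le (sq_nonneg _))
    (fun n _ => key n) le_rfl hn
  simpa using this

/-- Energy decay of the backward heat kernel. -/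
theorem tsum_mass_mul_Pn_sq_le (G : IsoGraph N d ι D) (hd : 1 < d) (hι : 0 < ι) (hD : 0 < D)
    (hC : 0 < C) (hγ : 0 < γ) :
    ∃ c > 0, ∀ π : ℕ → V → V → ℝ, (∀ t, Conductance N C γ (π t) (vc π t)) →
      (∀ t x, vc π t x ≤ vc π (t + 1) x) → ∀ (s n : ℕ) (y : V), 0 < n →
      ∑' x, vc π (s - 1) x * Pn π s n x y ^ 2 ≤ (n * c) ^ (-(d / 2)) := by
  have hD' : (0 : ℝ) < D := by exact_mod_cast hD
  obtain ⟨c, hc, hE⟩ := G.energy_avg_add_le hd hι hD (M := C * D) (by positivity) hC hγ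
  refine ⟨2 / d * c, by positivity, ?_⟩
  intro π H hmono s n y hn
  have hpos := fun n y => (H n).mass_pos G hC y
  set T := s + n with hT
  have hmono' : Monotone (vc π) := monotone_nat_of_le_succ fun t => hmono t
  set f : ℕ → V → ℝ := fun k x => Pn π (T - k) k x y with hf
  have hf0 : ∀ k x, 0 ≤ f k x := fun k x => Pn_nonneg_s2 G hC H _ _ x y
  have hfin : ∀ k, (f k).support.Finite := fun k => support_Pn_left_finite G H _ _ y
  have hsucc : ∀ k < T, f (k + 1) = avg N (π (T - k - 1)) (vc π (T - k - 1)) (f k) := by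
    intro k hk
    funext x
    simp only [hf]
    rw [Pn_succ_eq_avg G H, ← Nat.sub_sub, Nat.sub_add_cancel (by omega)]
  have hchange : ∀ k (g : ℝ → ℝ), g 0 = 0 → (∀ r, 0 ≤ r → 0 ≤ g r) →
      ∑' x, vc π (T - (k + 1) - 1) x * g (f (k + 1) x)
        ≤ ∑' x, vc π (T - k - 1) x * g (f (k + 1) x) := by
    intro k g hg hg0
    refine Summable.tsum_le_tsum (fun x => ?_)
      (summable_mul_of_support_finite (hfin _) _ g hg)
      (summable_mul_of_support_finite (hfin _) _ g hg)
    exact mul_le_mul_of_nonneg_right (hmono' (by omega) x) (hg0 _ (hf0 _ _))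
  have hmass : ∀ k ≤ T, ∑' x, vc π (T - k - 1) x * f k x ≤ C * D := by
    intro k
    induction k with
    | zero =>
      intro _
      rw [tsum_eq_single y fun x hx => by simp only [hf]; rw [Pn_zero_of_ne π _ hx, mul_zero]]
      simp only [hf]
      rw [Pn_zero_self, mul_one]
      exact (H _).mass_le G hC y
    | succ k ih =>
      intro hk
      refine (hchange k (fun r => r) rfl fun r hr => hr).trans ?_
      rw [hsucc k (by omega), (H _).tsum_mass_mul_avg G hC (hfin k)]
      exact ih (by omega)
  have key : ∀ k < T, ∑' x, vc π (T - (k + 1) - 1) x * f (k + 1) x ^ 2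
      ≤ ∑' x, vc π (T - k - 1) x * f k x ^ 2
        - c * (∑' x, vc π (T - k - 1) x * f k x ^ 2) ^ (1 + 2 / d) := by
    intro k hk
    have h1 := hE _ _ (f k) (H (T - k - 1)) (hf0 k) (hfin k) (hmass k hk.le)
    have h2 := hchange k (· ^ 2) (by simp) fun r _ => sq_nonneg r
    rw [← hsucc k hk] at h1
    linarith
  have := le_rpow_of_recursion (a := fun k => ∑' x, vc π (T - k - 1) x * f k x ^ 2) hc
    (δ := 2 / d) (by positivity) T
    (fun n _ => tsum_nonneg fun y => mul_nonneg (hpos _ y).le (sq_nonneg _))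
    key (n := n) (by omega) hn
  have hTn : T - n = s := by omega
  simpa [hf, hTn] using this

/-- A summable bound for the transition probabilities, uniform over all starting and end points,
when the vertex conductances are non-decreasing. -/
theorem exists_summable_Pn_le (G : IsoGraph N d ι D) (hd : 2 < d) (hι : 0 < ι) (hD : 0 < D)
    (hC : 0 < C) (hγ : 0 < γ) (H : ∀ t, Conductance N C γ (π t) (vc π t))
    (hmono : ∀ t x, vc π t x ≤ vc π (t + 1) x) :
    ∃ b : ℕ → ℝ, Summable b ∧ ∀ t x y, Pn π 0 t x y ≤ b t := by
  have hD' : (0 : ℝ) < D := by exact_mod_cast hD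
  have hpos := fun n y => (H n).mass_pos G hC y
  obtain ⟨c₁, hc₁, hfwd⟩ := tsum_mass_mul_hk_sq_le G (by linarith) hι hD hC hγ
  obtain ⟨c₂, hc₂, hbwd⟩ := tsum_mass_mul_Pn_sq_le G (by linarith) hι hD hC hγ
  set K := C * D * C with hK
  have hK0 : 0 < K := by positivity
  have hcompare : ∀ s t x, vc π s x ≤ K * vc π t x := by
    intro s t x
    refine ((H s).mass_le G hC x).trans ?_
    have := mul_le_mul_of_nonneg_left ((H t).le_mass G hC x) hK0.le
    rwa [hK, mul_inv_cancel_right₀ hC.ne', ← hK] at this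
  set A := (c₁ / 3) ^ (-(d / 2)) + K * (c₂ / 3) ^ (-(d / 2)) with hA
  have hA0 : 0 ≤ A := by positivity
  refine ⟨fun t => (if t < 2 then 1 else 0) + A * (t : ℝ) ^ (-(d / 2)), ?_, ?_⟩
  · refine Summable.add ?_ ((Real.summable_nat_rpow.2 (by linarith)).mul_left A)
    refine summable_of_hasFiniteSupport ((Set.finite_lt_nat 2).subset fun t ht => ?_)
    by_contra h
    exact ht (if_neg h)
  · intro t x y
    have hrp : 0 ≤ A * (t : ℝ) ^ (-(d / 2)) := by positivity
    by_cases ht : t < 2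
    · simp only [if_pos ht]
      linarith [Pn_le_one G hC H 0 t x y]
    simp only [if_neg ht, zero_add]
    have ht0 : (0 : ℝ) < t := by
      have : 0 < t := by omega
      exact_mod_cast this
    set m := t / 2 with hm
    have hm0 : 0 < m := by omega
    have hF := hfwd π H hmono m x hm0
    have hB := hbwd π H hmono m (t - m) y (by omega)
    have hdecay : ∀ c > 0, ∀ k : ℕ, m ≤ k →
        ((k : ℝ) * c) ^ (-(d / 2)) ≤ (c / 3) ^ (-(d / 2)) * (t : ℝ) ^ (-(d / 2)) := by
      intro c hc k hk
      rw [← Real.mul_rpow (by positivity) ht0.le]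
      refine Real.rpow_le_rpow_of_nonpos (by positivity) ?_ (by linarith)
      have : (t : ℝ) ≤ 3 * k := by
        have : t ≤ 3 * k := by omega
        exact_mod_cast this
      nlinarith
    have hF' := hF.trans (hdecay c₁ hc₁ m le_rfl)
    have hB' := hB.trans (hdecay c₂ hc₂ (t - m) (by omega))
    have hsF := summable_mul_of_support_finite (support_hk_finite G H m x) (vc π m) (· ^ 2)
      (by simp)
    have hsB := summable_mul_of_support_finite (support_Pn_left_finite G H m (t - m) y)
      (vc π (m - 1)) (· ^ 2) (by simp)
    have hfac : ∀ z, Pn π 0 m x z * Pn π m (t - m) z y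
        ≤ vc π m z * hk π 0 m x z ^ 2 + K * (vc π (m - 1) z * Pn π m (t - m) z y ^ 2) := by
      intro z
      have h1 := hcompare m (m - 1) z
      have h2 := hpos m z
      rw [← mass_mul_hk G hC H]
      have h3 : vc π m z * Pn π m (t - m) z y ^ 2
          ≤ K * vc π (m - 1) z * Pn π m (t - m) z y ^ 2 := by gcongr
      have h4 := mul_nonneg h2.le (sq_nonneg (hk π 0 m x z - Pn π m (t - m) z y))
      have h5 := mul_nonneg h2.le (sq_nonneg (hk π 0 m x z + Pn π m (t - m) z y))
      nlinarith
    have hsP : Summable fun z => Pn π 0 m x z * Pn π m (t - m) z y := by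
      refine summable_of_hasFiniteSupport
        ((support_Pn_finite G H 0 m x).subset fun z hz h => hz ?_)
      have h' : Pn π 0 m x z = 0 := h
      simp [h']
    have hCK := Pn_add G H 0 m (t - m) x y
    rw [zero_add, Nat.add_sub_cancel' (by omega)] at hCK
    rw [hCK]
    calc ∑' z, Pn π 0 m x z * Pn π m (t - m) z y
        ≤ ∑' z, (vc π m z * hk π 0 m x z ^ 2
            + K * (vc π (m - 1) z * Pn π m (t - m) z y ^ 2)) :=
          hsP.tsum_le_tsum hfac (hsF.add (hsB.mul_left K))
      _ = ∑' z, vc π m z * hk π 0 m x z ^ 2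
            + K * ∑' z, vc π (m - 1) z * Pn π m (t - m) z y ^ 2 := by
          rw [hsF.tsum_add (hsB.mul_left K), tsum_mul_left]
      _ ≤ (c₁ / 3) ^ (-(d / 2)) * (t : ℝ) ^ (-(d / 2))
            + K * ((c₂ / 3) ^ (-(d / 2)) * (t : ℝ) ^ (-(d / 2))) := by gcongr
      _ = A * (t : ℝ) ^ (-(d / 2)) := by rw [hA]; ring

theorem Pn_congr {π' : ℕ → V → V → ℝ} (h : ∀ t x y, step π' t x y = step π t x y) (s n : ℕ)
    (x y : V) : Pn π' s n x y = Pn π s n x y := by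
  induction n generalizing y with
  | zero => rfl
  | succ n ih => simp only [Pn, ih, h]

end HeatKernel

theorem Conductance.const_mul {V : Type} {N : V → Finset V} {C γ : ℝ} {q : V → V → ℝ} {w : V → ℝ}
    (H : Conductance N C γ q w) (hC : 0 < C) {r a b : ℝ} (ha : 0 < a) (har : a ≤ r) (hrb : r ≤ b) :
    Conductance N (max (C / a) (b * C)) γ (fun x y => r * q x y) (fun x => r * w x) where
  symm x y := by rw [H.symm]
  lower x y hy := by
    calc (max (C / a) (b * C))⁻¹ ≤ (C / a)⁻¹ := inv_anti₀ (by positivity) (le_max_left _ _)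
      _ = a * C⁻¹ := by rw [inv_div, div_eq_mul_inv]
      _ ≤ r * q x y := by
        exact mul_le_mul har (H.lower x y hy) (by positivity) (ha.le.trans har)
  upper x y hy := by
    calc r * q x y ≤ b * C :=
          mul_le_mul hrb (H.upper x y hy) (H.nonneg hC x y) (by linarith)
      _ ≤ _ := le_max_right _ _
  zero x y hy := by rw [H.zero x y hy, mul_zero]
  mass x := by rw [H.mass, Finset.mul_sum]
  lazy x := by
    have := H.lazy x
    have : 0 < r := by linarith
    nlinarith

/-- **Corollary 1.6 of Dembo–Huang–Morris–Peres.** On a bounded-degree graph with a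
uniform isoperimetric inequality of order `d > 2`, equipped with uniformly elliptic and
bounded time-varying edge conductances whose vertex conductances are effectively
non-decreasing, the uniformly lazy walk is strongly transient: `∑_t P(0,x;t,y) < ∞`,
and in particular for any initial distribution the expected number of visits to any
vertex is finite. -/
theorem transience_uniformly_elliptic
    {V : Type} [Countable V] (G : V → V → Prop) (π : ℕ → V → V → ℝ) (β : ℕ → ℝ)
    (d γ ι C₁ ηs : ℝ) (D : ℕ)
    (hd : 2 < d) (hγ : γ ∈ Set.Ioc (0 : ℝ) (1 / 2)) (hι : 0 < ι) (hC₁ : 0 < C₁)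
    -- the graph: symmetric, uniformly bounded degree
    (hGsymm : ∀ x y, G x y → G y x)
    (hGfin : ∀ x, ({y | G x y} : Set V).Finite)
    (hGdeg : ∀ x, ({y | G x y} : Set V).ncard ≤ D)
    -- uniform isoperimetric inequality of order `d`
    (hiso : ∀ A : Finset V, A.Nonempty →
      ι * (A.card : ℝ) ^ ((d - 1) / d) ≤ ∑ a ∈ A, (({b | G a b ∧ b ∉ A} : Set V).ncard : ℝ))
    -- conductances: symmetric, uniformly elliptic and bounded on edges/self-loops, zero elsewhere
    (hsymm : ∀ t x y, π t x y = π t y x)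
    (hell : ∀ t x y, (G x y ∨ x = y) → π t x y ∈ Set.Icc C₁⁻¹ C₁)
    (hzero : ∀ t x y, ¬(G x y ∨ x = y) → π t x y = 0)
    -- uniformly lazy
    (hlazy : ∀ t x, γ * vc π t x ≤ π t x x)
    -- effectively non-decreasing vertex conductances
    (hβ0 : β 0 = 1)
    (hβbdd : ∀ u, (ratioSet π u).Nonempty ∧ BddAbove (ratioSet π u))
    (hβ : ∀ u, β (u + 1) = β u * sSup (ratioSet π u))
    (hηs : ∀ u t : ℕ, u < t → β t ≤ ηs * β u) :
    (∀ x y : V, Summable fun t : ℕ => Pn π 0 t x y) ∧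
    (∀ μ₀ : V → ℝ, (∀ v, 0 ≤ μ₀ v) → HasSum μ₀ 1 →
      ∀ y : V, Summable fun p : ℕ × V => μ₀ p.2 * Pn π 0 p.1 p.2 y) := by
  classical
  have hγ0 : 0 < γ := hγ.1
  set N : V → Finset V := fun x => insert x (hGfin x).toFinset with hN
  have hmem : ∀ x y, y ∈ N x ↔ G x y ∨ x = y := by
    intro x y
    simp [hN, or_comm, eq_comm]
  have IG : IsoGraph N d ι (D + 1) :=
    { self_mem := fun x => Finset.mem_insert_self _ _
      symm := fun x y h => (hmem y x).2 (((hmem x y).1 h).imp (hGsymm x y) Eq.symm)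
      card_le := fun x => by
        refine (Finset.card_insert_le _ _).trans ?_
        rw [← Set.ncard_eq_toFinset_card _ (hGfin x)]
        exact Nat.add_le_add_right (hGdeg x) 1
      iso := fun A hA => by
        refine (hiso A hA).trans (Finset.sum_le_sum fun a ha => le_of_eq ?_)
        have hset : ({b | G a b ∧ b ∉ A} : Set V) = ↑((N a).filter (· ∉ A)) := by
          ext b
          simp only [Set.mem_ofPred_eq, Finset.coe_filter, hmem]
          constructor
          · exact fun h => ⟨Or.inl h.1, h.2⟩
          · rintro ⟨h | rfl, hb⟩
            · exact ⟨h, hb⟩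
            · exact absurd ha hb
        rw [hset, Set.ncard_coe_finset, Finset.card_filter]
        push_cast
        refine Finset.sum_congr rfl fun b _ => ?_
        by_cases hb : b ∈ A <;> simp [hb] }
  have hvc : ∀ t x, vc π t x = ∑ y ∈ N x, π t x y := fun t x =>
    tsum_eq_sum fun y hy => hzero t x y fun h => hy ((hmem x y).2 h)
  have H : ∀ t, Conductance N C₁ γ (π t) (vc π t) := fun t =>
    { symm := hsymm t
      lower := fun x y hy => (hell t x y ((hmem x y).1 hy)).1
      upper := fun x y hy => (hell t x y ((hmem x y).1 hy)).2
      zero := fun x y hy => hzero t x y fun h => hy ((hmem x y).2 h)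
      mass := hvc t
      lazy := hlazy t }
  have hpos := fun t x => (H t).mass_pos IG hC₁ x
  obtain ⟨_, o, -⟩ := (hβbdd 0).1
  have hratio : ∀ u x, vc π u x / vc π (u + 1) x ≤ sSup (ratioSet π u) := fun u x =>
    le_csSup (hβbdd u).2 ⟨x, hpos u x, rfl⟩
  have hβpos : ∀ t, 0 < β t := by
    intro t
    induction t with
    | zero => rw [hβ0]; exact one_pos
    | succ t ih =>
      rw [hβ]
      exact mul_pos ih ((div_pos (hpos t o) (hpos (t + 1) o)).trans_le (hratio t o))
  have hmono : ∀ t x, β t * vc π t x ≤ β (t + 1) * vc π (t + 1) x := by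
    intro t x
    have h := hratio t x
    rw [div_le_iff₀ (hpos _ _)] at h
    rw [hβ, mul_assoc]
    exact mul_le_mul_of_nonneg_left h (hβpos t).le
  have hβlower : ∀ t, C₁⁻¹ / (C₁ * (D + 1 : ℕ)) ≤ β t := by
    intro t
    have h1 : β 0 * vc π 0 o ≤ β t * vc π t o :=
      monotone_nat_of_le_succ (f := fun t => β t * vc π t o) (fun t => hmono t o) (Nat.zero_le t)
    rw [hβ0, one_mul] at h1
    rw [div_le_iff₀ (by positivity)]
    exact ((H 0).le_mass IG hC₁ o).trans
      (h1.trans (mul_le_mul_of_nonneg_left ((H t).mass_le IG hC₁ o) (hβpos t).le))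
  have hβupper : ∀ t, β t ≤ max ηs 1 := by
    intro t
    rcases Nat.eq_zero_or_pos t with rfl | ht
    · rw [hβ0]
      exact le_max_right _ _
    · have := hηs 0 t ht
      rw [hβ0, mul_one] at this
      exact this.trans (le_max_left _ _)
  set π' : ℕ → V → V → ℝ := fun t x y => β t * π t x y with hπ'
  have hvc' : ∀ t x, vc π' t x = β t * vc π t x := fun t x => tsum_mul_left
  have H' : ∀ t, Conductance N _ γ (π' t) (vc π' t) := fun t => by
    rw [funext (hvc' t)]
    exact (H t).const_mul hC₁ (a := C₁⁻¹ / (C₁ * (D + 1 : ℕ))) (by positivity) (hβlower t)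
      (hβupper t)
  have hstep : ∀ t x y, step π' t x y = step π t x y := fun t x y => by
    rw [step, step, hvc', mul_div_mul_left _ _ (hβpos t).ne']
  obtain ⟨b, hb, hPb⟩ := exists_summable_Pn_le IG hd hι (Nat.succ_pos D)
    (lt_max_of_lt_left (by positivity)) hγ0 H' (fun t x => by
      rw [hvc', hvc']
      exact hmono t x)
  have hP0 : ∀ t x y, 0 ≤ Pn π 0 t x y := Pn_nonneg_s2 IG hC₁ H 0
  have hP : ∀ t x y, Pn π 0 t x y ≤ b t := fun t x y => by
    rw [← Pn_congr hstep]
    exact hPb t x y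
  refine ⟨fun x y => hb.of_nonneg_of_le (fun t => hP0 t x y) fun t => hP t x y, ?_⟩
  intro μ₀ hμ₀ hsum y
  refine (hb.mul_of_nonneg hsum.summable (fun t => (hP0 t o o).trans (hP t o o)) hμ₀).of_nonneg_of_le
    (fun p => mul_nonneg (hμ₀ p.2) (hP0 p.1 p.2 y)) fun p => ?_
  rw [mul_comm (b p.1)]
  exact mul_le_mul_of_nonneg_left (hP p.1 p.2 y) (hμ₀ p.2)

end TimeVaryingConductances
end
end

section
/- For every α ∈ (0,1) and every y ∈ [0,1], one has (1/2)·[(1+y)^α + (1−y)^α] ≤ 1 + α(α−1)·y²/2 (note α(α−1) < 0, so this is an upper bound strictly below 1 for y > 0). -/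
/-- Bernoulli's inequality for non-positive real exponents. -/
theorem one_add_mul_le_rpow_one_add_of_nonpos {s p : ℝ} (hs : -1 < s) (hp : p ≤ 0) :
    1 + p * s ≤ (1 + s) ^ p := by
  have h0 : 0 < 1 + s := by linarith
  rw [Real.rpow_def_of_pos h0]
  have hlog : Real.log (1 + s) ≤ s := by linarith [Real.log_le_sub_one_of_pos h0]
  have hexp := Real.add_one_le_exp (Real.log (1 + s) * p)
  nlinarith

theorem hasDerivAt_one_add_rpow {x : ℝ} (p : ℝ) (hx : -1 < x) :
    HasDerivAt (fun t : ℝ => (1 + t) ^ p) (p * (1 + x) ^ (p - 1)) x := by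
  have h := ((hasDerivAt_id x).const_add 1).rpow_const (p := p)
    (Or.inl (show (1 : ℝ) + id x ≠ 0 by simp only [id]; linarith))
  simpa using h

theorem hasDerivAt_one_sub_rpow {x : ℝ} (p : ℝ) (hx : x < 1) :
    HasDerivAt (fun t : ℝ => (1 - t) ^ p) (-(p * (1 - x) ^ (p - 1))) x := by
  have h := ((hasDerivAt_id x).const_sub 1).rpow_const (p := p)
    (Or.inl (show (1 : ℝ) - id x ≠ 0 by simp only [id]; linarith))
  simpa using h

/-- For `p ≤ 0`, the odd part of `(1 + y) ^ p` lies below its linearization at `0`. -/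
theorem one_add_rpow_sub_one_sub_rpow_le {p y : ℝ} (hp : p ≤ 0) (hy0 : 0 ≤ y) (hy1 : y < 1) :
    (1 + y) ^ p - (1 - y) ^ p ≤ 2 * p * y := by
  have hd : ∀ x ∈ Set.Ico (0 : ℝ) 1,
      HasDerivAt (fun t : ℝ => (1 + t) ^ p - (1 - t) ^ p - 2 * p * t)
        (p * (1 + x) ^ (p - 1) - -(p * (1 - x) ^ (p - 1)) - 2 * p * 1) x := fun x hx =>
    ((hasDerivAt_one_add_rpow p (by linarith [hx.1])).sub
      (hasDerivAt_one_sub_rpow p hx.2)).sub ((hasDerivAt_id x).const_mul (2 * p))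
  have hanti : AntitoneOn (fun t : ℝ => (1 + t) ^ p - (1 - t) ^ p - 2 * p * t)
      (Set.Ico 0 1) := by
    refine antitoneOn_of_hasDerivWithinAt_nonpos (convex_Ico 0 1)
      (fun x hx => (hd x hx).continuousAt.continuousWithinAt)
      (fun x hx => (hd x (interior_subset hx)).hasDerivWithinAt) fun x hx => ?_
    obtain ⟨h0, h1⟩ := interior_subset hx
    have ha := one_add_mul_le_rpow_one_add_of_nonpos (s := x) (p := p - 1)
      (by linarith) (by linarith)
    have hb := one_add_mul_le_rpow_one_add_of_nonpos (s := -x) (p := p - 1)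
      (by linarith) (by linarith)
    rw [← sub_eq_add_neg] at hb
    nlinarith
  have h := hanti (Set.left_mem_Ico.2 one_pos) ⟨hy0, hy1⟩ hy0
  norm_num at h
  linarith

/-- Inequality (2.8) of Dembo–Huang–Morris–Peres: for `α ∈ (0,1)` and `y ∈ [0,1]`,
`f_α(y) = (1/2)[(1+y)^α + (1−y)^α] ≤ 1 + α(α−1) y²/2`. -/
theorem f_alpha_upper_bound (α y : ℝ) (hα : α ∈ Set.Ioo (0 : ℝ) 1)
    (hy : y ∈ Set.Icc (0 : ℝ) 1) :
    (1 / 2) * ((1 + y) ^ α + (1 - y) ^ α) ≤ 1 + α * (α - 1) * y ^ 2 / 2 := by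
  obtain ⟨hα0, hα1⟩ := hα
  have hcont : Continuous fun t : ℝ => (1 + t) ^ α + (1 - t) ^ α - α * (α - 1) * t ^ 2 :=
    (((continuous_const.add continuous_id).rpow_const fun _ => Or.inr hα0.le).add
      ((continuous_const.sub continuous_id).rpow_const fun _ => Or.inr hα0.le)).sub
      (continuous_const.mul (continuous_id.pow 2))
  have hanti : AntitoneOn (fun t : ℝ => (1 + t) ^ α + (1 - t) ^ α - α * (α - 1) * t ^ 2)
      (Set.Icc 0 1) := by
    refine antitoneOn_of_hasDerivWithinAt_nonpos (convex_Icc 0 1) hcont.continuousOn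
      (f' := fun x => α * (1 + x) ^ (α - 1) + -(α * (1 - x) ^ (α - 1))
        - α * (α - 1) * (2 * x)) (fun x hx => ?_) fun x hx => ?_
    all_goals
      rw [interior_Icc] at hx
      obtain ⟨h0, h1⟩ := hx
    · have hsq : HasDerivAt (fun t : ℝ => t ^ 2) (2 * x) x := by
        simpa using hasDerivAt_pow 2 x
      exact (((hasDerivAt_one_add_rpow α (by linarith)).add
        (hasDerivAt_one_sub_rpow α h1)).sub (hsq.const_mul _)).hasDerivWithinAt
    · have h := one_add_rpow_sub_one_sub_rpow_le (p := α - 1) (by linarith) h0.le h1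
      nlinarith
  have h := hanti (Set.left_mem_Icc.2 zero_le_one) hy hy.1
  norm_num at h
  linarith
end

section
/- For every α ≥ 1 and every y ∈ [0,1], one has (1/2)·[(1+y)^α + (1−y)^α] ≥ 1 + α(α−1)·y²/8. -/
/-- A linear lower bound for the odd part of `(1 + y) ^ b`, from Bernoulli's inequality. -/
theorem mul_le_one_add_rpow_sub_one_sub_rpow {b y : ℝ} (hb : 0 ≤ b) (hy₀ : 0 ≤ y) (hy₁ : y ≤ 1) :
    b * y ≤ (1 + y) ^ b - (1 - y) ^ b := by
  rcases le_total 1 b with h | h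
  · have h₁ := one_add_mul_self_le_rpow_one_add (s := y) (by linarith) h
    have h₂ : (1 - y) ^ b ≤ 1 := Real.rpow_le_one (by linarith) (by linarith) hb
    linarith
  · have h₁ := rpow_one_add_le_one_add_mul_self (s := -y) (by linarith) hb h
    have h₂ : 1 ≤ (1 + y) ^ b := Real.one_le_rpow (by linarith) hb
    rw [← sub_eq_add_neg] at h₁
    linarith

/-- Inequality (2.9) of Dembo–Huang–Morris–Peres: for `α ≥ 1` and `y ∈ [0,1]`,
`f_α(y) = (1/2)[(1+y)^α + (1−y)^α] ≥ 1 + α(α−1) y²/8`. -/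
theorem f_alpha_lower_bound (α y : ℝ) (hα : 1 ≤ α) (hy : y ∈ Set.Icc (0 : ℝ) 1) :
    1 + α * (α - 1) * y ^ 2 / 8 ≤ (1 / 2) * ((1 + y) ^ α + (1 - y) ^ α) := by
  let g : ℝ → ℝ := fun x ↦ (1 / 2) * ((1 + x) ^ α + (1 - x) ^ α) - α * (α - 1) * x ^ 2 / 8
  have hg (x : ℝ) : HasDerivAt g
      (α / 2 * ((1 + x) ^ (α - 1) - (1 - x) ^ (α - 1)) - α * (α - 1) * x / 4) x := by
    have h₁ := ((hasDerivAt_id x).const_add 1).rpow_const (p := α) (Or.inr hα)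
    have h₂ := ((hasDerivAt_id x).const_sub 1).rpow_const (p := α) (Or.inr hα)
    have h₃ := (((hasDerivAt_id x).pow 2).const_mul (α * (α - 1))).div_const 8
    refine (((h₁.add h₂).const_mul (1 / 2)).sub h₃).congr_deriv ?_
    simp only [id]
    ring
  have hmono : MonotoneOn g (Set.Icc 0 1) := by
    refine monotoneOn_of_deriv_nonneg (convex_Icc 0 1)
      (fun x _ ↦ (hg x).continuousAt.continuousWithinAt)
      (fun x _ ↦ (hg x).differentiableAt.differentiableWithinAt) fun x hx ↦ ?_
    obtain ⟨hx₀, hx₁⟩ := interior_subset hx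
    rw [(hg x).deriv]
    have hb : 0 ≤ α - 1 := by linarith
    have h := mul_le_mul_of_nonneg_left (mul_le_one_add_rpow_sub_one_sub_rpow hb hx₀ hx₁)
      (show 0 ≤ α / 2 by linarith)
    have : 0 ≤ α * (α - 1) * x := by positivity
    linarith
  have h := hmono (Set.left_mem_Icc.2 zero_le_one) hy hy.1
  norm_num [g] at h
  linarith
end

section
/- Let Z be a non-negative random variable with E[Z] = 1, let α ∈ (0,1), δ > 0 and set β = α − δ(1−α). Then E[Z^β·1_{Z>0}] ≥ (E[Z^α])^{1+δ} (with the left side interpreted in [0,∞], allowing the value +∞). -/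
open MeasureTheory

/-- Inequality (2.12) of Dembo–Huang–Morris–Peres: if `Z ≥ 0` has mean one,
`α ∈ (0,1)`, `δ > 0` and `β = α − δ(1−α)`, then `E[Z^β 1_{Z>0}] ≥ (E[Z^α])^{1+δ}`
(the left side taken in `[0,∞]`). -/
theorem mean_one_rpow_inequality
    {Ω : Type} [MeasurableSpace Ω] (μ : Measure Ω) [IsProbabilityMeasure μ]
    (Z : Ω → ℝ) (hZmeas : Measurable Z) (hZnonneg : ∀ ω, 0 ≤ Z ω)
    (hZmean : ∫⁻ ω, ENNReal.ofReal (Z ω) ∂μ = 1)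
    (α δ β : ℝ) (hα : α ∈ Set.Ioo (0 : ℝ) 1) (hδ : 0 < δ) (hβ : β = α - δ * (1 - α)) :
    (∫⁻ ω, ENNReal.ofReal (Z ω ^ α) ∂μ) ^ (1 + δ) ≤
      ∫⁻ ω in {ω | 0 < Z ω}, ENNReal.ofReal (Z ω ^ β) ∂μ := by
  have hα0 : 0 < α := hα.1
  have hδ1 : 0 < 1 + δ := by linarith
  have hS : MeasurableSet {ω | 0 < Z ω} := measurableSet_lt measurable_const hZmeas
  have hp : (0 : ℝ) ≤ (1 + δ)⁻¹ := by positivity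
  have hq : 0 ≤ δ * (1 + δ)⁻¹ := by positivity
  have hpq : (1 + δ)⁻¹ + δ * (1 + δ)⁻¹ = 1 := by field_simp
  have hexp : β * (1 + δ)⁻¹ + δ * (1 + δ)⁻¹ = α := by
    rw [hβ]
    field_simp
    ring
  have hrestrict : ∫⁻ ω, ENNReal.ofReal (Z ω ^ α) ∂μ =
      ∫⁻ ω in {ω | 0 < Z ω}, ENNReal.ofReal (Z ω ^ α) ∂μ := by
    refine (setLIntegral_eq_of_support_subset fun ω hω ↦ ?_).symm
    refine (hZnonneg ω).lt_of_ne fun h ↦ hω ?_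
    simp [← h, Real.zero_rpow hα0.ne']
  have hsplit : ∫⁻ ω in {ω | 0 < Z ω}, ENNReal.ofReal (Z ω ^ α) ∂μ =
      ∫⁻ ω in {ω | 0 < Z ω}, ENNReal.ofReal (Z ω ^ β) ^ (1 + δ)⁻¹ *
        ENNReal.ofReal (Z ω) ^ (δ * (1 + δ)⁻¹) ∂μ := by
    refine setLIntegral_congr_fun hS fun ω (hω : 0 < Z ω) ↦ ?_
    rw [← ENNReal.ofReal_rpow_of_pos hω, ← ENNReal.ofReal_rpow_of_pos hω, ← ENNReal.rpow_mul,
      ← ENNReal.rpow_add _ _ (by simpa using hω) ENNReal.ofReal_ne_top, hexp]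
  have hle : ∫⁻ ω, ENNReal.ofReal (Z ω ^ α) ∂μ ≤
      (∫⁻ ω in {ω | 0 < Z ω}, ENNReal.ofReal (Z ω ^ β) ∂μ) ^ (1 + δ)⁻¹ := by
    rw [hrestrict, hsplit]
    calc
      _ ≤ (∫⁻ ω in {ω | 0 < Z ω}, ENNReal.ofReal (Z ω ^ β) ∂μ) ^ (1 + δ)⁻¹ *
          (∫⁻ ω in {ω | 0 < Z ω}, ENNReal.ofReal (Z ω) ∂μ) ^ (δ * (1 + δ)⁻¹) :=
        ENNReal.lintegral_mul_norm_pow_le (hZmeas.pow_const β).ennreal_ofReal.aemeasurable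
          hZmeas.ennreal_ofReal.aemeasurable hp hq hpq
      _ ≤ _ := mul_le_of_le_one_right' (ENNReal.rpow_le_one
        ((setLIntegral_le_lintegral _ _).trans_eq hZmean) hq)
  calc
    _ ≤ ((∫⁻ ω in {ω | 0 < Z ω}, ENNReal.ofReal (Z ω ^ β) ∂μ) ^ (1 + δ)⁻¹) ^ (1 + δ) :=
      ENNReal.rpow_le_rpow hle hδ1.le
    _ = _ := ENNReal.rpow_inv_rpow hδ1.ne' _
end

section
/- Let a, δ > 0 and let (κ_t)_{t∈ℕ} be non-negative reals with ψ(t) = Σ_{u=0}^{t−1} κ_u². Suppose (m_t)_{t∈ℕ} is a sequence of non-negative reals satisfying m_{t+1} ≤ m_t·exp(−a·κ_t²·m_t^δ) for all t. Then there is a finite constant c′ (depending only on a, δ and m_0) such that m_t ≤ c′·ψ(t)^{−1/δ} for all t with ψ(t) > 0. -/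
/-- If `y_{t+1} ≤ y_t exp(−b_t y_t)` with `b, y ≥ 0`, then `y_t ∑_{u<t} b_u ≤ 1`. -/
theorem mul_sum_le_one_of_le_mul_exp {b y : ℕ → ℝ} (hb : ∀ t, 0 ≤ b t) (hy : ∀ t, 0 ≤ y t)
    (h : ∀ t, y (t + 1) ≤ y t * Real.exp (-(b t * y t))) (t : ℕ) :
    y t * ∑ u ∈ Finset.range t, b u ≤ 1 := by
  induction t with
  | zero => simp
  | succ t ih =>
    have hpos : 0 < 1 + b t * y t := by linarith [mul_nonneg (hb t) (hy t)]
    have hexp : Real.exp (-(b t * y t)) ≤ (1 + b t * y t)⁻¹ := by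
      rw [Real.exp_neg]
      exact inv_anti₀ hpos (by linarith [Real.add_one_le_exp (b t * y t)])
    have hsum : 0 ≤ ∑ u ∈ Finset.range (t + 1), b u := Finset.sum_nonneg fun u _ => hb u
    calc y (t + 1) * ∑ u ∈ Finset.range (t + 1), b u
        ≤ (y t * (1 + b t * y t)⁻¹) * ∑ u ∈ Finset.range (t + 1), b u :=
          mul_le_mul_of_nonneg_right
            ((h t).trans (mul_le_mul_of_nonneg_left hexp (hy t))) hsum
      _ = (y t * ∑ u ∈ Finset.range t, b u + b t * y t) / (1 + b t * y t) := by
          rw [Finset.sum_range_succ]; ring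
      _ ≤ 1 := by rw [div_le_one hpos]; linarith

/-- Inequality (2.13) of Dembo–Huang–Morris–Peres, iterated: if `m_{t+1} ≤
m_t exp(−a κ_t² m_t^δ)` for non-negative sequences, then `m_t ≤ c′ ψ(t)^{−1/δ}`
whenever `ψ(t) = ∑_{u<t} κ_u² > 0`, for some finite `c′` depending only on `a`, `δ`
and `m₀`. -/
theorem decay_from_recursion (a δ m₀ : ℝ) (ha : 0 < a) (hδ : 0 < δ) :
    ∃ c : ℝ, ∀ (κ : ℕ → ℝ), (∀ u, 0 ≤ κ u) →
      ∀ m : ℕ → ℝ, (∀ t, 0 ≤ m t) → m 0 = m₀ →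
      (∀ t, m (t + 1) ≤ m t * Real.exp (-(a * κ t ^ 2 * m t ^ δ))) →
      ∀ t : ℕ, 0 < ∑ u ∈ Finset.range t, κ u ^ 2 →
        m t ≤ c * (∑ u ∈ Finset.range t, κ u ^ 2) ^ (-(1 / δ)) := by
  refine ⟨(a * δ) ^ (-(1 / δ)), fun κ _ m hm _ hrec t ht => ?_⟩
  have hstep : ∀ t, m (t + 1) ^ δ ≤
      m t ^ δ * Real.exp (-((a * δ * κ t ^ 2) * m t ^ δ)) := fun t => by
    refine (Real.rpow_le_rpow (hm _) (hrec t) hδ.le).trans_eq ?_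
    rw [Real.mul_rpow (hm t) (Real.exp_pos _).le, ← Real.exp_mul]
    ring_nf
  have hbound := mul_sum_le_one_of_le_mul_exp
    (fun t => mul_nonneg (mul_pos ha hδ).le (sq_nonneg (κ t)))
    (fun t => Real.rpow_nonneg (hm t) δ) hstep t
  have haδ : 0 < a * δ := mul_pos ha hδ
  rw [← Finset.mul_sum] at hbound
  rw [← Real.mul_rpow haδ.le ht.le, Real.rpow_neg (mul_pos haδ ht).le,
    ← Real.inv_rpow (mul_pos haδ ht).le, one_div, Real.le_rpow_inv_iff_of_pos (hm t)
      (inv_nonneg.2 (mul_pos haδ ht).le) hδ, ← one_div, le_div_iff₀ (mul_pos haδ ht)]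
  exact hbound
end

section
/- Let γ ∈ (0,1/2] and t ∈ ℕ. Suppose π^{(t+1)}(y) ≥ π^{(t)}(y) for every y ∈ V and π^{(t)}(y,y) ≥ γ·π^{(t)}(y) for every y. Then for every finite A ⊆ V with π^{(t)}(A) > 0, Σ_{y∈V} min(π^{(t+1)}(y), 2·π^{(t)}(A,y)) ≥ π^{(t)}(A) + (2γ/(1−γ))·π^{(t)}(A,A^c). -/
open MeasureTheory

noncomputable section

namespace TimeVaryingConductances

lemma inv_one_sub_mul_le_min {γ v p : ℝ} (hγ : γ ≤ 1 / 2) (hp : 0 ≤ p)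
    (h : p + γ * v ≤ v) : 1 / (1 - γ) * p ≤ min v (2 * p) := by
  have hg : 0 < 1 - γ := by linarith
  rw [one_div_mul_eq_div, le_min_iff, div_le_iff₀ hg, div_le_iff₀ hg]
  constructor <;> nlinarith

lemma add_sub_mul_le_min {γ v p q : ℝ} (hγ : γ ≤ 1 / 2) (hq : 0 ≤ q)
    (hv : v = p + q) (h : γ * v ≤ p) :
    v + (2 * γ / (1 - γ) - 1 / (1 - γ)) * q ≤ min v (2 * p) := by
  have hg : 0 < 1 - γ := by linarith
  have e : (2 * γ / (1 - γ) - 1 / (1 - γ)) * q = (2 * γ - 1) * q / (1 - γ) := by ring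
  rw [e, le_min_iff]
  constructor
  · have : (2 * γ - 1) * q / (1 - γ) ≤ 0 :=
      div_nonpos_of_nonpos_of_nonneg (mul_nonpos_of_nonpos_of_nonneg (by linarith) hq) hg.le
    linarith
  · rw [← le_sub_iff_add_le', div_le_iff₀ hg]
    subst hv
    linarith

/-- Inequality (2.7) of Dembo–Huang–Morris–Peres: if `π^{(t+1)}(y) ≥ π^{(t)}(y)` and
the walk is `γ`-lazy at time `t`, then for any finite `A` with `π^{(t)}(A) > 0`,
`∑_y min(π^{(t+1)}(y), 2 π^{(t)}(A,y)) ≥ π^{(t)}(A) + (2γ/(1−γ)) π^{(t)}(A,Aᶜ)`. -/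
theorem min_sum_lower_bound
    {V : Type} [Countable V] (π : ℕ → V → V → ℝ) (γ : ℝ) (t : ℕ)
    (hγ : γ ∈ Set.Ioc (0 : ℝ) (1 / 2))
    (hnonneg : ∀ t x y, 0 ≤ π t x y)
    (hsymm : ∀ t x y, π t x y = π t y x)
    (hfin : ∀ t x, {y | π t x y ≠ 0}.Finite)
    (hmono : ∀ y, vc π t y ≤ vc π (t + 1) y)
    (hlazy : ∀ y, γ * vc π t y ≤ π t y y)
    (A : Finset V) (hA : 0 < fMass π t A) :
    fMass π t A + 2 * γ / (1 - γ) * fCut π t A ≤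
      ∑' y, min (vc π (t + 1) y) (2 * ∑ a ∈ A, π t a y) := by
  classical
  obtain ⟨-, hγ⟩ := hγ
  have hsum (x : V) : Summable (π t x) := summable_of_hasFiniteSupport (hfin t x)
  have hvc (s : ℕ) (x : V) : 0 ≤ vc π s x := tsum_nonneg (hnonneg s x)
  set p : V → ℝ := fun y ↦ ∑ a ∈ A, π t a y
  have hp0 (y : V) : 0 ≤ p y := Finset.sum_nonneg fun a _ ↦ hnonneg t a y
  have hps (y : V) : ∑ a ∈ A, π t y a = p y := Finset.sum_congr rfl fun a _ ↦ hsymm t y a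
  set S : Finset V := A ∪ A.biUnion fun a ↦ (hfin t a).toFinset
  have hAS : A ⊆ S := Finset.subset_union_left
  have hout {a b : V} (ha : a ∈ A) (hb : b ∉ S) : π t a b = 0 := by
    by_contra h
    exact hb (Finset.mem_union_right _ (Finset.mem_biUnion.2 ⟨a, ha, by simpa using h⟩))
  set q : V → ℝ := fun a ↦ ∑ b ∈ S \ A, π t a b
  have hq0 (y : V) : 0 ≤ q y := Finset.sum_nonneg fun b _ ↦ hnonneg t y b
  have hcut : fCut π t A = ∑ a ∈ A, q a := by
    refine Finset.sum_congr rfl fun a ha ↦ ?_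
    rw [tsum_eq_sum (s := S \ A)]
    · exact Finset.sum_congr rfl fun b hb ↦ if_neg (Finset.mem_sdiff.1 hb).2
    · intro b hb
      split_ifs with h
      · rfl
      · exact hout ha fun hbS ↦ hb (Finset.mem_sdiff.2 ⟨hbS, h⟩)
  have hcut' : ∑ b ∈ S \ A, p b = ∑ a ∈ A, q a := Finset.sum_comm
  have hsplit {a : V} (ha : a ∈ A) : vc π t a = p a + q a := by
    rw [vc, tsum_eq_sum (s := S) fun b hb ↦ hout ha hb, ← hps, add_comm]
    exact (Finset.sum_sdiff hAS).symm
  have hin {a : V} (ha : a ∈ A) : γ * vc π t a ≤ p a :=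
    (hlazy a).trans (Finset.single_le_sum (f := fun b ↦ π t b a)
      (fun b _ ↦ hnonneg t b a) ha)
  have hnotin {y : V} (hy : y ∉ A) : p y + γ * vc π t y ≤ vc π t y := by
    have h := (hsum y).sum_le_tsum (insert y A) fun b _ ↦ hnonneg t y b
    rw [Finset.sum_insert hy, hps] at h
    have := hlazy y
    change _ ≤ vc π t y at h
    linarith
  have hmin (y : V) : min (vc π t y) (2 * p y) ≤ min (vc π (t + 1) y) (2 * p y) :=
    min_le_min_right _ (hmono y)
  rw [tsum_eq_sum (s := S), ← Finset.sum_sdiff hAS]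
  · have h₁ := Finset.sum_le_sum fun y (hy : y ∈ S \ A) ↦
      (inv_one_sub_mul_le_min hγ (hp0 y) (hnotin (Finset.mem_sdiff.1 hy).2)).trans (hmin y)
    have h₂ := Finset.sum_le_sum fun y (hy : y ∈ A) ↦
      (add_sub_mul_le_min hγ (hq0 y) (hsplit hy) (hin hy)).trans (hmin y)
    rw [← Finset.mul_sum, hcut'] at h₁
    rw [Finset.sum_add_distrib, ← Finset.mul_sum] at h₂
    rw [hcut, fMass]
    linarith
  · intro y hy
    have : p y = 0 := Finset.sum_eq_zero fun a ha ↦ hout ha hy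
    change min _ (2 * p y) = 0
    rw [this, mul_zero, min_eq_right (hvc _ _)]

end TimeVaryingConductances
end
end
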